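/- arXiv:1702.01564 — 3 statements merged into one kernel-verified Lean document; each statement's English description precedes it below -/
import Mathlib

section
/- Let m ≥ 1 be an integer, let σ(k) = Σ_{d∣k} d denote the sum-of-divisors function, and set S_m(t) = Σ_{1≤k≤⌊t⌋} k^m σ(k) for t > 0. Define 𝓔₄(R) = Σ_{ω∈ℤ⁴} |ω|^{2m} · 1_{|ω|≤R}. Then for every R > 0, 𝓔₄(R) = 8 S_m(R²) − 4^m · 32 · S_m(R²/4). -/
open MeasureTheory Filter Asymptotics Finset

theorem abs_le_sq (x : ℤ) : |x| ≤ x ^ 2 := by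
  rw [Int.abs_eq_natAbs]
  exact Int.natAbs_le_self_sq x

/-- The solutions `(x, d, e)` of `x² + d e = n` with `d, e` positive. -/
noncomputable def liouvilleTriples (n : ℤ) : Finset (ℤ × ℤ × ℤ) :=
  {p ∈ Icc (-n) n ×ˢ Icc 1 n ×ˢ Icc 1 n | p.1 ^ 2 + p.2.1 * p.2.2 = n}

theorem mem_liouvilleTriples {n x d e : ℤ} :
    (x, d, e) ∈ liouvilleTriples n ↔ x ^ 2 + d * e = n ∧ 0 < d ∧ 0 < e := by
  simp only [liouvilleTriples, mem_filter, mem_product, mem_Icc]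
  constructor
  · rintro ⟨⟨-, ⟨hd, -⟩, he, -⟩, h⟩
    exact ⟨h, by omega, by omega⟩
  · rintro ⟨h, hd, he⟩
    have h1 : 0 < d * e := mul_pos hd he
    have h2 : d ≤ d * e := by nlinarith
    have h3 : e ≤ d * e := by nlinarith
    have h5 : |x| ≤ n := by linarith [abs_le_sq x]
    refine ⟨⟨abs_le.1 h5, ⟨by omega, ?_⟩, by omega, ?_⟩, h⟩ <;> nlinarith [sq_nonneg x]

/-- The sign that is `-1` when `d` and `e` are both even and `1` otherwise. -/
def evenPairSign (d e : ℤ) : ℤ := if Even d ∧ Even e then -1 else 1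

theorem evenPairSign_comm (d e : ℤ) : evenPairSign d e = evenPairSign e d := by
  simp only [evenPairSign, and_comm]

theorem evenPairSign_left_shift (x d e : ℤ) :
    evenPairSign d (e - d - 2 * x) = evenPairSign d e := by
  simp only [evenPairSign, Int.even_sub, even_two_mul, iff_true]
  refine if_congr ?_ rfl rfl
  tauto

theorem evenPairSign_right_shift (x d e : ℤ) :
    evenPairSign (d + 2 * x - e) e = evenPairSign d e := by
  simp only [evenPairSign, Int.even_sub, Int.even_add, even_two_mul, iff_true]
  refine if_congr ?_ rfl rfl
  tauto

theorem sum_liouvilleTriples_of_lt (n : ℤ) :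
    ∑ p ∈ liouvilleTriples n with 0 < p.2.2 - p.2.1 - 2 * p.1, evenPairSign p.2.1 p.2.2 *
      ((2 * p.1 + p.2.1) * (p.2.2 - 2 * p.1) * (p.2.1 + p.2.2)) = 0 := by
  refine self_eq_neg.1 ?_
  rw [← sum_neg_distrib]
  refine sum_nbij' (fun p ↦ (-p.1 - p.2.1, p.2.1, p.2.2 - p.2.1 - 2 * p.1))
    (fun p ↦ (-p.1 - p.2.1, p.2.1, p.2.2 - p.2.1 - 2 * p.1)) ?_ ?_ ?_ ?_ ?_
  iterate 2
    rintro ⟨x, d, e⟩ h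
    simp only [mem_filter, mem_liouvilleTriples] at h ⊢
    obtain ⟨⟨rfl, hd, he⟩, h⟩ := h
    exact ⟨⟨by ring, hd, h⟩, by linarith⟩
  iterate 2
    rintro ⟨x, d, e⟩ -
    ext <;> simp; ring
  rintro ⟨x, d, e⟩ -
  simp only [evenPairSign_left_shift]
  ring

theorem sum_liouvilleTriples_of_gt (n : ℤ) :
    ∑ p ∈ liouvilleTriples n with p.2.2 - p.2.1 - 2 * p.1 < 0, evenPairSign p.2.1 p.2.2 *
      ((2 * p.1 + p.2.1) * (p.2.2 - 2 * p.1) * (p.2.1 + p.2.2)) = 0 := by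
  refine self_eq_neg.1 ?_
  rw [← sum_neg_distrib]
  refine sum_nbij' (fun p ↦ (p.2.2 - p.1, p.2.1 + 2 * p.1 - p.2.2, p.2.2))
    (fun p ↦ (p.2.2 - p.1, p.2.1 + 2 * p.1 - p.2.2, p.2.2)) ?_ ?_ ?_ ?_ ?_
  iterate 2
    rintro ⟨x, d, e⟩ h
    simp only [mem_filter, mem_liouvilleTriples] at h ⊢
    obtain ⟨⟨rfl, hd, he⟩, h⟩ := h
    exact ⟨⟨by ring, by linarith, he⟩, by linarith⟩
  iterate 2
    rintro ⟨x, d, e⟩ -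
    ext <;> simp; ring
  rintro ⟨x, d, e⟩ -
  simp only [evenPairSign_right_shift]
  ring

theorem sum_range_two_mul_alternating (c : ℤ) (t : ℕ) :
    ∑ i ∈ range (2 * t), (-1) ^ (i + 1) * ((i : ℤ) * (c - i)) = c * t - 2 * t ^ 2 + t := by
  induction t with
  | zero => simp
  | succ t ih =>
    rw [show 2 * (t + 1) = 2 * t + 1 + 1 by ring, sum_range_succ, sum_range_succ, ih]
    simp only [pow_succ, pow_mul]
    push_cast
    norm_num
    ring

theorem sum_liouvilleTriples_of_eq_sq (s : ℕ) (hs : 0 < s) :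
    ∑ p ∈ liouvilleTriples ((s : ℤ) ^ 2) with p.2.2 - p.2.1 - 2 * p.1 = 0,
      evenPairSign p.2.1 p.2.2 *
      ((2 * p.1 + p.2.1) * (p.2.2 - 2 * p.1) * (p.2.1 + p.2.2)) = 2 * s ^ 2 := by
  have hroot : ∀ {x d e : ℤ}, x ^ 2 + d * e = (s : ℤ) ^ 2 → 0 < d → 0 < e →
      e - d - 2 * x = 0 → x + d = s := by
    intro x d e h1 hd he h2
    obtain rfl : e = d + 2 * x := by linarith
    have : (x + d) ^ 2 = (s : ℤ) ^ 2 := by rw [← h1]; ring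
    rcases sq_eq_sq_iff_eq_or_eq_neg.1 this with h | h
    · exact h
    · omega
  have key := sum_range_two_mul_alternating (2 * s) s
  have h0 : ∑ i ∈ range (2 * s), (-1) ^ (i + 1) * ((i : ℤ) * (2 * s - i)) =
      ∑ i ∈ Ioo 0 (2 * s), (-1) ^ (i + 1) * ((i : ℤ) * (2 * s - i)) := by
    refine (sum_subset (fun i hi ↦ ?_) fun i hi hi' ↦ ?_).symm
    · simp only [mem_Ioo, mem_range] at *; omega
    · have : i = 0 := by simp only [mem_Ioo, mem_range] at *; omega
      simp [this]
  rw [h0] at key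
  trans 2 * s * (2 * s * s - 2 * s ^ 2 + s : ℤ)
  · rw [← key, mul_sum]
    refine sum_nbij' (fun p ↦ p.2.1.toNat) (fun i ↦ ((s : ℤ) - i, (i : ℤ), 2 * (s : ℤ) - i))
      ?_ ?_ ?_ ?_ ?_
    · rintro ⟨x, d, e⟩ h
      simp only [mem_filter, mem_liouvilleTriples, mem_Ioo] at h ⊢
      obtain ⟨⟨h1, hd, he⟩, h2⟩ := h
      have : d < 2 * s := by
        obtain rfl : e = d + 2 * x := by linarith
        by_contra! h3
        nlinarith
      omega
    · intro i hi
      simp only [mem_filter, mem_liouvilleTriples, mem_Ioo] at hi ⊢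
      exact ⟨⟨by ring, by omega, by omega⟩, by ring⟩
    · rintro ⟨x, d, e⟩ h
      simp only [mem_filter, mem_liouvilleTriples] at h
      obtain ⟨⟨h1, hd, he⟩, h2⟩ := h
      have hx := hroot h1 hd he h2
      ext <;> simp <;> omega
    · intro i hi
      simp
    · rintro ⟨x, d, e⟩ h
      simp only [mem_filter, mem_liouvilleTriples] at h
      obtain ⟨⟨h1, hd, he⟩, h2⟩ := h
      have hx := hroot h1 hd he h2
      lift d to ℕ using hd.le
      obtain rfl : x = s - d := by linarith
      obtain rfl : e = 2 * s - d := by linarith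
      have hsign : evenPairSign d (2 * s - d) = (-1) ^ (d + 1) := by
        simp only [evenPairSign, Int.even_sub, even_two_mul]
        rcases Nat.even_or_odd d with h | h
        · simp [h, pow_succ]
        · have : ¬ Even (d : ℤ) := by simpa using h
          simp [this, h, pow_succ]
      simp only [hsign, Int.toNat_natCast]
      ring
  · ring

theorem filter_liouvilleTriples_eq_empty {n : ℤ} (hn : ¬ ∃ s : ℕ, (s : ℤ) ^ 2 = n) :
    {p ∈ liouvilleTriples n | p.2.2 - p.2.1 - 2 * p.1 = 0} = ∅ := by
  refine filter_eq_empty_iff.2 ?_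
  rintro ⟨x, d, e⟩ h h0
  simp only [mem_liouvilleTriples] at h h0
  refine hn ⟨(x + d).natAbs, ?_⟩
  rw [Int.natCast_natAbs, sq_abs, ← h.1]
  linear_combination -d * h0

theorem sum_liouvilleTriples (n : ℤ) :
    ∑ p ∈ liouvilleTriples n, evenPairSign p.2.1 p.2.2 *
      ((2 * p.1 + p.2.1) * (p.2.2 - 2 * p.1) * (p.2.1 + p.2.2)) =
    ∑ p ∈ liouvilleTriples n with p.2.2 - p.2.1 - 2 * p.1 = 0, evenPairSign p.2.1 p.2.2 *
      ((2 * p.1 + p.2.1) * (p.2.2 - 2 * p.1) * (p.2.1 + p.2.2)) := by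
  have h1 := sum_liouvilleTriples_of_lt n
  have h2 := sum_liouvilleTriples_of_gt n
  rw [sum_filter] at h1 h2 ⊢
  refine Eq.trans ?_ ((congrArg₂ (· + ·) (congrArg₂ (· + ·) rfl h1) h2).trans
    ((add_zero _).trans (add_zero _)))
  simp only [← sum_add_distrib]
  refine sum_congr rfl fun p _ ↦ ?_
  rcases lt_trichotomy (p.2.2 - p.2.1 - 2 * p.1) 0 with h | h | h
  · rw [if_neg h.ne, if_neg h.not_gt, if_pos h, zero_add, zero_add]
  · rw [h, if_pos rfl, if_neg (lt_irrefl _), add_zero, add_zero]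
  · rw [if_neg h.ne', if_pos h, if_neg h.not_gt, zero_add, add_zero]

theorem two_mul_sum_liouvilleTriples (n : ℤ) :
    2 * ∑ p ∈ liouvilleTriples n, evenPairSign p.2.1 p.2.2 *
      ((p.2.1 * p.2.2 - 4 * p.1 ^ 2) * p.2.1) =
    ∑ p ∈ liouvilleTriples n, evenPairSign p.2.1 p.2.2 *
      ((2 * p.1 + p.2.1) * (p.2.2 - 2 * p.1) * (p.2.1 + p.2.2)) := by
  have hneg : ∑ p ∈ liouvilleTriples n, evenPairSign p.2.1 p.2.2 *
      ((2 * p.1 + p.2.1) * (p.2.2 - 2 * p.1) * (p.2.1 + p.2.2)) =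
      ∑ p ∈ liouvilleTriples n, evenPairSign p.2.1 p.2.2 *
      ((2 * -p.1 + p.2.1) * (p.2.2 - 2 * -p.1) * (p.2.1 + p.2.2)) := by
    refine sum_nbij' (fun p ↦ (-p.1, p.2)) (fun p ↦ (-p.1, p.2)) ?_ ?_ ?_ ?_ ?_ <;>
      rintro ⟨x, d, e⟩ <;> simp [mem_liouvilleTriples]
  have hswap : ∑ p ∈ liouvilleTriples n, evenPairSign p.2.1 p.2.2 *
      ((p.2.1 * p.2.2 - 4 * p.1 ^ 2) * p.2.1) =
      ∑ p ∈ liouvilleTriples n, evenPairSign p.2.1 p.2.2 *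
      ((p.2.1 * p.2.2 - 4 * p.1 ^ 2) * p.2.2) := by
    refine sum_nbij' (fun p ↦ (p.1, p.2.2, p.2.1)) (fun p ↦ (p.1, p.2.2, p.2.1)) ?_ ?_ ?_ ?_ ?_ <;>
      rintro ⟨x, d, e⟩ <;> simp [mem_liouvilleTriples]
    · intro h hd he
      exact ⟨by rw [mul_comm, h], he, hd⟩
    · intro h hd he
      exact ⟨by rw [mul_comm, h], he, hd⟩
    · intros
      rw [evenPairSign_comm, mul_comm d e]
  have h2 : 2 * ∑ p ∈ liouvilleTriples n, evenPairSign p.2.1 p.2.2 *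
      ((2 * p.1 + p.2.1) * (p.2.2 - 2 * p.1) * (p.2.1 + p.2.2)) =
      2 * (∑ p ∈ liouvilleTriples n, evenPairSign p.2.1 p.2.2 *
      ((p.2.1 * p.2.2 - 4 * p.1 ^ 2) * p.2.1) + ∑ p ∈ liouvilleTriples n,
      evenPairSign p.2.1 p.2.2 * ((p.2.1 * p.2.2 - 4 * p.1 ^ 2) * p.2.2)) := by
    nth_rw 1 [two_mul]
    nth_rw 2 [hneg]
    rw [← sum_add_distrib, ← sum_add_distrib, mul_sum]
    exact sum_congr rfl fun p _ ↦ by ring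
  rw [← hswap] at h2
  linarith

/-- The sum of `± d` over factorizations `k = d e`, the sign being negative when `d` and `e` are
both even. -/
noncomputable def signedSigma (k : ℤ) : ℤ :=
  ∑ p ∈ Icc 1 k ×ˢ Icc 1 k with p.1 * p.2 = k, evenPairSign p.1 p.2 * p.1

theorem mem_factorizations {k d e : ℤ} :
    (d, e) ∈ {p ∈ Icc 1 k ×ˢ Icc 1 k | p.1 * p.2 = k} ↔ d * e = k ∧ 0 < d ∧ 0 < e := by
  simp only [mem_filter, mem_product, mem_Icc]
  constructor
  · rintro ⟨⟨⟨hd, -⟩, he, -⟩, h⟩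
    exact ⟨h, by omega, by omega⟩
  · rintro ⟨h, hd, he⟩
    exact ⟨⟨⟨by omega, by nlinarith⟩, by omega, by nlinarith⟩, h⟩

theorem sum_mul_signedSigma (n : ℤ) :
    ∑ x ∈ Icc (-n) n, (n - 5 * x ^ 2) * signedSigma (n - x ^ 2) =
    ∑ p ∈ liouvilleTriples n, evenPairSign p.2.1 p.2.2 *
      ((p.2.1 * p.2.2 - 4 * p.1 ^ 2) * p.2.1) := by
  simp only [signedSigma, mul_sum]
  rw [sum_sigma']
  refine sum_nbij' (fun p ↦ (p.1, p.2)) (fun p ↦ ⟨p.1, p.2⟩) ?_ ?_ ?_ ?_ ?_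
  · rintro ⟨x, d, e⟩ h
    rw [mem_sigma, mem_factorizations] at h
    rw [mem_liouvilleTriples]
    exact ⟨by linarith [h.2.1], h.2.2⟩
  · rintro ⟨x, d, e⟩ h
    rw [mem_sigma, mem_factorizations]
    refine ⟨?_, ?_⟩
    · simp only [liouvilleTriples, mem_filter, mem_product] at h
      exact h.1.1
    · rw [mem_liouvilleTriples] at h
      exact ⟨by linarith [h.1], h.2⟩
  · intros; rfl
  · intros; rfl
  · rintro ⟨x, d, e⟩ h
    rw [mem_sigma, mem_factorizations] at h
    have h1 : d * e = n - x ^ 2 := h.2.1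
    simp only [h1]
    ring

theorem sum_mul_signedSigma_sq (s : ℕ) (hs : 0 < s) :
    ∑ x ∈ Icc (-(s : ℤ) ^ 2) ((s : ℤ) ^ 2),
      ((s : ℤ) ^ 2 - 5 * x ^ 2) * signedSigma ((s : ℤ) ^ 2 - x ^ 2) = (s : ℤ) ^ 2 := by
  have h := two_mul_sum_liouvilleTriples ((s : ℤ) ^ 2)
  rw [sum_liouvilleTriples, sum_liouvilleTriples_of_eq_sq s hs, ← sum_mul_signedSigma] at h
  linarith

theorem sum_mul_signedSigma_of_not_sq {n : ℤ} (hn : ¬ ∃ s : ℕ, (s : ℤ) ^ 2 = n) :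
    ∑ x ∈ Icc (-n) n, (n - 5 * x ^ 2) * signedSigma (n - x ^ 2) = 0 := by
  have h := two_mul_sum_liouvilleTriples n
  rw [sum_liouvilleTriples, filter_liouvilleTriples_eq_empty hn, sum_empty,
    ← sum_mul_signedSigma] at h
  linarith

/-- The recurrence satisfied by the Jacobi four-square formula. -/
theorem sum_mul_jacobi {n : ℤ} (hn : 0 < n) :
    ∑ x ∈ Icc (-n) n, (n - 5 * x ^ 2) *
      (8 * signedSigma (n - x ^ 2) + if n - x ^ 2 = 0 then 1 else 0) = 0 := by
  simp only [mul_add, sum_add_distrib, mul_left_comm _ (8 : ℤ), ← mul_sum]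
  by_cases h : ∃ s : ℕ, (s : ℤ) ^ 2 = n
  · obtain ⟨s, rfl⟩ := h
    have hs : 0 < s := by
      rcases Nat.eq_zero_or_pos s with rfl | h
      · simp at hn
      · exact h
    rw [sum_mul_signedSigma_sq s hs]
    have : ∑ x ∈ Icc (-(s : ℤ) ^ 2) ((s : ℤ) ^ 2), ((s : ℤ) ^ 2 - 5 * x ^ 2) *
        (if (s : ℤ) ^ 2 - x ^ 2 = 0 then 1 else 0) = ∑ x ∈ {(s : ℤ), -(s : ℤ)},
        ((s : ℤ) ^ 2 - 5 * x ^ 2) := by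
      simp only [mul_ite, mul_one, mul_zero]
      rw [← sum_filter]
      refine sum_congr ?_ fun _ _ ↦ rfl
      ext x
      simp only [mem_filter, mem_Icc, mem_insert, mem_singleton]
      rw [sub_eq_zero, eq_comm, sq_eq_sq_iff_eq_or_eq_neg]
      refine and_iff_right_of_imp ?_
      rintro (rfl | rfl) <;> constructor <;> nlinarith
    rw [this, sum_pair (by omega)]
    ring
  · rw [sum_mul_signedSigma_of_not_sq h, mul_zero, zero_add]
    refine sum_eq_zero fun x _ ↦ ?_
    rw [if_neg, mul_zero]
    intro h0
    exact h ⟨x.natAbs, by rw [Int.natCast_natAbs, sq_abs]; linarith⟩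

/-- The representations of `n` as a sum of `k` integer squares. -/
noncomputable def squareReps (k : ℕ) (n : ℤ) : Finset (Fin k → ℤ) :=
  {ω ∈ Fintype.piFinset fun _ ↦ Icc (-n) n | ∑ i, ω i ^ 2 = n}

theorem mem_squareReps {k : ℕ} {n : ℤ} {ω : Fin k → ℤ} :
    ω ∈ squareReps k n ↔ ∑ i, ω i ^ 2 = n := by
  simp only [squareReps, mem_filter, Fintype.mem_piFinset, mem_Icc, and_iff_right_iff_imp]
  intro h i
  rw [← abs_le, ← h]
  exact (abs_le_sq _).trans
    (single_le_sum (f := fun i ↦ ω i ^ 2) (fun i _ ↦ sq_nonneg _) (mem_univ i))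

theorem squareReps_of_neg (k : ℕ) {n : ℤ} (hn : n < 0) : squareReps k n = ∅ := by
  refine eq_empty_of_forall_notMem fun ω h ↦ ?_
  rw [mem_squareReps] at h
  have : 0 ≤ ∑ i, ω i ^ 2 := sum_nonneg fun i _ ↦ sq_nonneg _
  omega

theorem squareReps_zero (k : ℕ) : squareReps k 0 = {0} := by
  ext ω
  rw [mem_squareReps, sum_eq_zero_iff_of_nonneg fun i _ ↦ sq_nonneg _, mem_singleton, funext_iff]
  simp

theorem sum_squareReps_succ (k : ℕ) (n : ℤ) :
    ∑ ω ∈ squareReps (k + 1) n, (n - (k + 1) * ω 0 ^ 2) = 0 := by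
  have h : ∀ i, ∑ ω ∈ squareReps (k + 1) n, ω i ^ 2 = ∑ ω ∈ squareReps (k + 1) n, ω 0 ^ 2 := by
    intro i
    refine sum_nbij' (fun ω ↦ ω ∘ Equiv.swap 0 i) (fun ω ↦ ω ∘ Equiv.swap 0 i) ?_ ?_ ?_ ?_ ?_
    iterate 2
      intro ω hω
      rw [mem_squareReps] at hω ⊢
      rw [← hω]
      exact Equiv.sum_comp (Equiv.swap 0 i) fun j ↦ ω j ^ 2
    iterate 2
      intro ω _
      ext j
      simp
    intro ω _
    simp
  have h2 : ∑ ω ∈ squareReps (k + 1) n, n = ∑ ω ∈ squareReps (k + 1) n, ∑ i, ω i ^ 2 :=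
    sum_congr rfl fun ω hω ↦ (mem_squareReps.1 hω).symm
  rw [sum_comm, sum_congr rfl fun i _ ↦ h i] at h2
  rw [sum_sub_distrib, h2, ← mul_sum]
  simp

theorem sum_mul_card_squareReps (k : ℕ) (n : ℤ) :
    ∑ x ∈ Icc (-n) n, (n - (k + 1) * x ^ 2) * #(squareReps k (n - x ^ 2)) = 0 := by
  rw [← sum_squareReps_succ k n]
  simp only [mul_comm _ (#(squareReps k _) : ℤ), ← nsmul_eq_mul, ← sum_const]
  rw [sum_sigma']
  refine sum_nbij' (fun p ↦ Fin.cons p.1 p.2) (fun ω ↦ ⟨ω 0, Fin.tail ω⟩) ?_ ?_ ?_ ?_ ?_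
  · rintro ⟨x, ω⟩ h
    rw [mem_sigma, mem_squareReps] at h
    rw [mem_squareReps, Fin.sum_univ_succ]
    simp only [Fin.cons_zero, Fin.cons_succ, h.2]
    ring
  · intro ω h
    rw [mem_sigma, mem_squareReps]
    refine ⟨Fintype.mem_piFinset.1 (mem_filter.1 h).1 0, ?_⟩
    rw [mem_squareReps, Fin.sum_univ_succ] at h
    simp only [Fin.tail]
    linarith
  · rintro ⟨x, ω⟩ _
    simp
  · intro ω _
    simp
  · rintro ⟨x, ω⟩ _
    simp

theorem signedSigma_of_nonpos {k : ℤ} (hk : k ≤ 0) : signedSigma k = 0 := by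
  rw [signedSigma, Icc_eq_empty (by omega)]
  simp

/-- **Jacobi's four-square theorem**, in terms of `signedSigma`. -/
theorem card_squareReps_four (n : ℕ) :
    (#(squareReps 4 n) : ℤ) = 8 * signedSigma n + if (n : ℤ) = 0 then 1 else 0 := by
  induction n using Nat.strong_induction_on with
  | _ n ih =>
  rcases Nat.eq_zero_or_pos n with rfl | hn
  · simp [squareReps_zero, signedSigma_of_nonpos]
  have h1 := sum_mul_card_squareReps 4 n
  have h2 := sum_mul_jacobi (n := n) (by exact_mod_cast hn)
  have h0 : (0 : ℤ) ∈ Icc (-(n : ℤ)) n := by simp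
  rw [← add_sum_erase _ _ h0] at h1 h2
  have h3 : ∀ x ∈ (Icc (-(n : ℤ)) n).erase 0, (#(squareReps 4 (n - x ^ 2)) : ℤ) =
      8 * signedSigma (n - x ^ 2) + if (n : ℤ) - x ^ 2 = 0 then 1 else 0 := by
    intro x hx
    have hx0 : 0 < x ^ 2 := by
      have := ne_of_mem_erase hx
      positivity
    rcases lt_or_ge ((n : ℤ) - x ^ 2) 0 with h | h
    · rw [squareReps_of_neg _ h, signedSigma_of_nonpos h.le, if_neg h.ne]
      simp
    · obtain ⟨k, hk⟩ := Int.eq_ofNat_of_zero_le h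
      rw [hk]
      exact ih k (by omega)
  rw [sum_congr rfl fun x hx ↦ by rw [h3 x hx]] at h1
  norm_num at h1 h2
  have hn' : (n : ℤ) ≠ 0 := by omega
  refine mul_left_cancel₀ hn' ?_
  simp only [Int.natCast_eq_zero, mul_add]
  linarith

theorem signedSigma_natCast (n : ℕ) :
    signedSigma n = ∑ d ∈ n.divisors, (d : ℤ) -
      4 * if 4 ∣ n then ∑ d ∈ (n / 4).divisors, (d : ℤ) else 0 := by
  rcases Nat.eq_zero_or_pos n with rfl | hn
  · simp [signedSigma_of_nonpos]
  have h1 : signedSigma n =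
      ∑ p ∈ n.divisorsAntidiagonal, evenPairSign p.1 p.2 * (p.1 : ℤ) := by
    refine sum_nbij' (fun p ↦ (p.1.toNat, p.2.toNat)) (fun p ↦ ((p.1 : ℤ), (p.2 : ℤ)))
      ?_ ?_ ?_ ?_ ?_
    · rintro ⟨d, e⟩ h
      rw [mem_factorizations] at h
      obtain ⟨h, hd, he⟩ := h
      lift d to ℕ using hd.le
      lift e to ℕ using he.le
      rw [Nat.mem_divisorsAntidiagonal]
      exact ⟨by simpa using mod_cast h, hn.ne'⟩
    · rintro ⟨d, e⟩ h
      rw [Nat.mem_divisorsAntidiagonal] at h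
      rw [mem_factorizations]
      obtain ⟨rfl, -⟩ := h
      exact ⟨by simp, by exact_mod_cast pos_of_mul_pos_left hn (Nat.zero_le _),
        by exact_mod_cast pos_of_mul_pos_right hn (Nat.zero_le _)⟩
    · rintro ⟨d, e⟩ h
      rw [mem_factorizations] at h
      simp [h.2.1.le, h.2.2.le]
    · intros
      simp
    · rintro ⟨d, e⟩ h
      rw [mem_factorizations] at h
      simp [h.2.1.le, h.2.2.le]
  have h2 : ∑ p ∈ n.divisorsAntidiagonal with Even p.1 ∧ Even p.2, (p.1 : ℤ) =
      2 * if 4 ∣ n then ∑ d ∈ (n / 4).divisors, (d : ℤ) else 0 := by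
    split_ifs with h4
    · obtain ⟨k, rfl⟩ := h4
      rw [Nat.mul_div_cancel_left _ (by norm_num),
        ← Nat.sum_divisorsAntidiagonal (fun d _ ↦ (d : ℤ)), mul_sum]
      refine sum_nbij' (fun p ↦ (p.1 / 2, p.2 / 2)) (fun p ↦ (2 * p.1, 2 * p.2)) ?_ ?_ ?_ ?_ ?_
      · rintro ⟨d, e⟩ h
        simp only [mem_filter, Nat.mem_divisorsAntidiagonal, even_iff_two_dvd] at h ⊢
        obtain ⟨⟨h, -⟩, ⟨a, rfl⟩, b, rfl⟩ := h
        refine ⟨?_, by omega⟩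
        rw [Nat.mul_div_cancel_left _ two_pos, Nat.mul_div_cancel_left _ two_pos]
        linarith
      · rintro ⟨d, e⟩ h
        simp only [mem_filter, Nat.mem_divisorsAntidiagonal, even_two_mul, and_self, and_true]
          at h ⊢
        exact ⟨by rw [← h.1]; ring, by omega⟩
      · rintro ⟨d, e⟩ h
        simp only [mem_filter, even_iff_two_dvd] at h
        simp [Nat.mul_div_cancel' h.2.1, Nat.mul_div_cancel' h.2.2]
      · intros
        simp
      · rintro ⟨d, e⟩ h
        simp only [mem_filter, even_iff_two_dvd] at h
        obtain ⟨-, ⟨a, rfl⟩, -⟩ := h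
        simp
    · rw [mul_zero]
      refine sum_eq_zero ?_
      rintro ⟨d, e⟩ h
      simp only [mem_filter, Nat.mem_divisorsAntidiagonal, even_iff_two_dvd] at h
      exact absurd (h.1.1 ▸ mul_dvd_mul h.2.1 h.2.2) h4
  rw [h1, ← Nat.sum_divisorsAntidiagonal (fun d _ ↦ (d : ℤ)), show (4 : ℤ) = 2 * 2 by norm_num,
    mul_assoc, ← h2, sum_filter, mul_sum, ← sum_sub_distrib]
  refine sum_congr rfl fun p _ ↦ ?_
  simp only [evenPairSign, Int.even_coe_nat]
  split_ifs <;> ring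

/-- **Jacobi's four-square theorem.** -/
theorem card_squareReps_four_eq_sum_divisors {n : ℕ} (hn : n ≠ 0) :
    (#(squareReps 4 n) : ℤ) = 8 * ∑ d ∈ n.divisors, (d : ℤ) -
      32 * if 4 ∣ n then ∑ d ∈ (n / 4).divisors, (d : ℤ) else 0 := by
  rw [card_squareReps_four, signedSigma_natCast, if_neg (Nat.cast_ne_zero.2 hn)]
  ring

/-- Summing a function of `|ω|²` over the lattice points of a ball of `ℝᵏ`. -/
theorem tsum_lattice_ball (k m : ℕ) (hm : m ≠ 0) (R : ℝ) (hR : 0 ≤ R) :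
    ∑' ω : Fin k → ℤ,
      (if ‖((EuclideanSpace.equiv (Fin k) ℝ).symm fun i => (ω i : ℝ))‖ ≤ R then
        ‖((EuclideanSpace.equiv (Fin k) ℝ).symm fun i => (ω i : ℝ))‖ ^ (2 * m) else 0) =
    ∑ n ∈ Icc 1 ⌊R ^ 2⌋₊, (n : ℝ) ^ m * #(squareReps k n) := by
  have hnorm : ∀ ω : Fin k → ℤ,
      ‖((EuclideanSpace.equiv (Fin k) ℝ).symm fun i => (ω i : ℝ))‖ ^ 2 =
        ((∑ i, ω i ^ 2 : ℤ) : ℝ) := by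
    intro ω
    rw [EuclideanSpace.norm_sq_eq]
    simp
  rw [tsum_eq_sum (s := (Icc 1 ⌊R ^ 2⌋₊).biUnion fun n ↦ squareReps k n)]
  · rw [sum_biUnion]
    · refine sum_congr rfl fun n hn ↦ ?_
      rw [mul_comm ((n : ℝ) ^ m), ← nsmul_eq_mul, ← sum_const]
      refine sum_congr rfl fun ω hω ↦ ?_
      have h := hnorm ω
      rw [mem_squareReps.1 hω, Int.cast_natCast] at h
      rw [if_pos, pow_mul, h]
      rw [← sq_le_sq₀ (norm_nonneg _) hR, h]
      exact (Nat.le_floor_iff (sq_nonneg R)).1 (mem_Icc.1 hn).2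
    · intro a _ b _ hab
      refine disjoint_left.2 fun ω ha hb ↦ hab ?_
      rw [mem_squareReps] at ha hb
      exact_mod_cast ha.symm.trans hb
  · intro ω hω
    simp only [mem_biUnion, mem_squareReps, mem_Icc, not_exists, not_and] at hω
    rw [ite_eq_right_iff]
    intro hle
    obtain ⟨n, hn⟩ := Int.eq_ofNat_of_zero_le (sum_nonneg fun i _ ↦ sq_nonneg (ω i) :
      0 ≤ ∑ i, ω i ^ 2)
    have h := hnorm ω
    rw [hn, Int.cast_natCast] at h
    rw [pow_mul, h]
    rcases Nat.eq_zero_or_pos n with rfl | hpos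
    · simp [hm]
    · refine absurd hn (hω n ⟨hpos, Nat.le_floor ?_⟩)
      rw [← h]
      gcongr

theorem sum_Icc_four_dvd (f : ℕ → ℝ) (t : ℝ) :
    ∑ n ∈ Icc 1 ⌊t⌋₊ with 4 ∣ n, f n = ∑ j ∈ Icc 1 ⌊t / 4⌋₊, f (4 * j) := by
  have h4 : ⌊t / 4⌋₊ = ⌊t⌋₊ / 4 := Nat.floor_div_ofNat t 4
  rw [h4]
  refine sum_nbij' (fun n ↦ n / 4) (fun j ↦ 4 * j) ?_ ?_ ?_ ?_ ?_ <;> intro n hn <;>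
    simp only [mem_filter, mem_Icc] at hn ⊢
  · omega
  · omega
  · omega
  · omega
  · rw [Nat.mul_div_cancel' hn.2]

/-- **Jacobi four-square identity for the weighted count (identity (5.5)).**
For an integer `m ≥ 1`, with `σ(k) = Σ_{d∣k} d`, `S_m(t) = Σ_{1≤k≤⌊t⌋} k^m σ(k)` and
`𝓔₄(R) = Σ_{ω∈ℤ⁴} |ω|^{2m} 1_{|ω|≤R}`, one has for every `R > 0`
`𝓔₄(R) = 8 S_m(R²) − 4^m · 32 · S_m(R²/4)`. -/
theorem stmt13 (m : ℕ) (hm : 1 ≤ m)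
    (σ : ℕ → ℕ) (hσ : ∀ k, σ k = ∑ d ∈ k.divisors, d)
    (S : ℝ → ℝ) (hS : ∀ t : ℝ, S t = ∑ k ∈ Finset.Icc 1 ⌊t⌋₊, (k : ℝ) ^ m * (σ k : ℝ))
    (𝓔 : ℝ → ℝ)
    (h𝓔 : ∀ R : ℝ, 𝓔 R = ∑' ω : Fin 4 → ℤ,
      if ‖((EuclideanSpace.equiv (Fin 4) ℝ).symm fun i => (ω i : ℝ))‖ ≤ R then
        ‖((EuclideanSpace.equiv (Fin 4) ℝ).symm fun i => (ω i : ℝ))‖ ^ (2 * m) else 0) :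
    ∀ R : ℝ, 0 < R → 𝓔 R = 8 * S (R ^ 2) - 4 ^ m * 32 * S (R ^ 2 / 4) := by
  intro R hR
  rw [h𝓔, tsum_lattice_ball 4 m (by omega) R hR.le, hS, hS, mul_sum, mul_sum]
  have h := sum_Icc_four_dvd (fun n ↦ 32 * ((n : ℝ) ^ m * σ (n / 4))) (R ^ 2)
  have h' : ∑ j ∈ Icc 1 ⌊R ^ 2 / 4⌋₊, 4 ^ m * 32 * ((j : ℝ) ^ m * (σ j : ℝ)) =
      ∑ j ∈ Icc 1 ⌊R ^ 2 / 4⌋₊,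
        32 * (((4 * j : ℕ) : ℝ) ^ m * (σ (4 * j / 4) : ℝ)) := by
    refine sum_congr rfl fun j _ ↦ ?_
    rw [Nat.mul_div_cancel_left _ (by norm_num), Nat.cast_mul, mul_pow]
    push_cast
    ring
  rw [h', ← h, sum_filter, ← sum_sub_distrib]
  refine sum_congr rfl fun n hn ↦ ?_
  have hn0 : n ≠ 0 := by
    have := (mem_Icc.1 hn).1
    omega
  have hJ := congrArg (Int.cast : ℤ → ℝ) (card_squareReps_four_eq_sum_divisors hn0)
  simp only [hσ]
  push_cast at hJ ⊢
  rw [hJ]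
  split_ifs <;> ring
end

section
/- Let m ≥ 1 be an integer, let ψ(x) = x − ⌊x⌋ − 1/2, let D(t) = Σ_{1≤k≤⌊t⌋} (1/k) ψ(t/k), and for t > 0 and integers 1 ≤ j ≤ ⌊√t⌋ define F(t,j) = Σ_{k=0}^{m} (binom(m,k)/(k+2)) · j^{2(m−k)} (t − j²)^{k+1}. Then the sum H(t) = Σ_{j=1}^{⌊√t⌋} F(t,j) D(t − j²) satisfies H(t) = O(t^{m+3/2}) as t → ∞, and likewise L(t) = Σ_{j=1}^{⌊√t⌋} F(t,j) D((t − j²)/4) satisfies L(t) = O(t^{m+3/2}) as t → ∞. -/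
open MeasureTheory Filter Asymptotics Finset

lemma sum_stdAddChar_mul {q : ℕ} [NeZero q] (t : ZMod q) :
    ∑ i : ZMod q, ZMod.stdAddChar (t * i) = if t = 0 then (q : ℂ) else 0 := by
  split_ifs with h
  · simp [h, ZMod.card]
  · exact AddChar.sum_eq_zero_of_ne_one (ZMod.isPrimitive_stdAddChar q h)

/-- The squared modulus of a quadratic Gauss sum, bounded by Weyl differencing. -/
lemma norm_sq_gaussSum_le {q : ℕ} [NeZero q] (h : ZMod q) :
    ‖∑ i : ZMod q, ZMod.stdAddChar (h * i ^ 2)‖ ^ 2 ≤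
      q * (#{d : ZMod q | 2 * h * d = 0} : ℝ) := by
  have key : (∑ i : ZMod q, ZMod.stdAddChar (h * i ^ 2)) *
      (starRingEnd ℂ) (∑ i : ZMod q, ZMod.stdAddChar (h * i ^ 2)) =
      ∑ d : ZMod q, ZMod.stdAddChar (h * d ^ 2) *
        (if 2 * h * d = 0 then (q : ℂ) else 0) := by
    have : ∀ d : ZMod q, ZMod.stdAddChar (h * d ^ 2) * (if 2 * h * d = 0 then (q : ℂ) else 0) =
        ∑ j : ZMod q, ZMod.stdAddChar (h * (d + j) ^ 2) * ZMod.stdAddChar (-(h * j ^ 2)) := by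
      intro d
      rw [← sum_stdAddChar_mul, mul_sum]
      refine sum_congr rfl fun j _ => ?_
      rw [← AddChar.map_add_eq_mul, ← AddChar.map_add_eq_mul]
      congr 1
      ring
    simp_rw [this]
    rw [sum_comm, map_sum, sum_mul_sum, sum_comm]
    refine sum_congr rfl fun j _ => ?_
    rw [← Equiv.sum_comp (Equiv.addRight j)]
    refine sum_congr rfl fun d _ => ?_
    rw [Equiv.coe_addRight, AddChar.map_neg_eq_conj]
  have hnorm := congrArg norm key
  rw [Complex.mul_conj', ← Complex.ofReal_pow, Complex.norm_real,
    Real.norm_of_nonneg (by positivity)] at hnorm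
  rw [hnorm]
  refine (norm_sum_le _ _).trans ?_
  rw [card_filter, Nat.cast_sum, mul_sum]
  refine sum_le_sum fun d _ => ?_
  rw [norm_mul, AddChar.norm_apply, one_mul]
  split_ifs <;> simp

lemma card_two_mul_mul_eq_zero_le {q : ℕ} [NeZero q] (h : ZMod q) :
    #{d : ZMod q | 2 * h * d = 0} ≤ Nat.gcd (2 * h.valMinAbs.natAbs) q := by
  have hq : 0 < Nat.gcd (2 * h.valMinAbs.natAbs) q := Nat.gcd_pos_of_pos_right _ (NeZero.pos q)
  refine le_trans (card_le_card ?_) (IsAddCyclic.card_nsmul_eq_zero_le (α := ZMod q) hq)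
  intro d hd
  simp only [mem_filter, mem_univ, true_and] at hd ⊢
  have h1 : (2 * h.valMinAbs.natAbs) • d = 0 := by
    rw [nsmul_eq_mul]
    push_cast
    have hh : ((h.valMinAbs : ℤ) : ZMod q) = h := ZMod.coe_valMinAbs h
    rcases Int.natAbs_eq h.valMinAbs with e | e
    · rw [e, Int.cast_natCast] at hh; rw [hh]; exact hd
    · rw [e, Int.cast_neg, Int.cast_natCast] at hh
      linear_combination -hd - 2 * d * hh
  have h2 : q • d = 0 := by simp
  rw [← addOrderOf_dvd_iff_nsmul_eq_zero] at *
  exact Nat.dvd_gcd h1 h2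

/-- A lower bound for the distance of an additive character value from `1`. -/
lemma le_norm_stdAddChar_sub_one {q : ℕ} [NeZero q] (h : ZMod q) :
    4 * (h.valMinAbs.natAbs : ℝ) / q ≤ ‖ZMod.stdAddChar h - 1‖ := by
  have hq : (0 : ℝ) < q := by exact_mod_cast NeZero.pos q
  have e : ZMod.stdAddChar h =
      Complex.exp (Complex.I * ((2 * Real.pi * h.valMinAbs / q : ℝ) : ℂ)) := by
    conv_lhs => rw [← ZMod.coe_valMinAbs h]
    rw [ZMod.stdAddChar_coe]
    congr 1
    push_cast
    ring
  rw [e, Complex.norm_exp_I_mul_ofReal_sub_one, Real.norm_eq_abs, abs_mul]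
  have hle : (h.valMinAbs.natAbs : ℝ) ≤ q / 2 := by
    have := ZMod.natAbs_valMinAbs_le h
    have h2 : 2 * h.valMinAbs.natAbs ≤ q := by omega
    have : (2 : ℝ) * h.valMinAbs.natAbs ≤ q := by exact_mod_cast h2
    linarith
  have habs : |Real.sin (2 * Real.pi * h.valMinAbs / q / 2)| =
      |Real.sin (Real.pi * h.valMinAbs.natAbs / q)| := by
    rw [Nat.cast_natAbs, Int.cast_abs]
    rcases abs_choice (h.valMinAbs : ℝ) with e | e <;> rw [e]
    · congr 2; ring
    · rw [← abs_neg, ← Real.sin_neg]; congr 2; ring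
  have hs := Real.mul_le_sin (x := Real.pi * h.valMinAbs.natAbs / q) (by positivity)
    (by rw [div_le_div_iff₀ hq two_pos]; nlinarith [Real.pi_pos])
  rw [habs, abs_of_pos (two_pos : (0 : ℝ) < 2)]
  have := hs.trans (le_abs_self _)
  calc _ = 2 * (2 / Real.pi * (Real.pi * h.valMinAbs.natAbs / q)) := by
        field_simp
        ring
    _ ≤ _ := by linarith

lemma sum_range_mul_pow (x : ℂ) (n : ℕ) :
    (x - 1) * ∑ k ∈ range n, (k : ℂ) * x ^ k = n * x ^ n - x * ∑ k ∈ range n, x ^ k := by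
  induction n with
  | zero => simp
  | succ n ih =>
    rw [sum_range_succ, sum_range_succ, mul_add, ih]
    push_cast
    ring

/-- Discrete Fourier coefficients of the sawtooth `z ↦ z / q`. -/
lemma norm_dft_val_le {q : ℕ} [NeZero q] {h : ZMod q} (hh : h ≠ 0) :
    ‖ZMod.dft (fun z : ZMod q => (z.val : ℂ) / q) h‖ ≤ q / (4 * h.valMinAbs.natAbs) := by
  have hq : (0 : ℝ) < q := by exact_mod_cast NeZero.pos q
  have hqc : (q : ℂ) ≠ 0 := by exact_mod_cast hq.ne'
  have hx1 : ZMod.stdAddChar (-h) ≠ 1 := by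
    intro e
    rw [← AddChar.map_zero_eq_one (ZMod.stdAddChar (N := q))] at e
    exact hh (neg_eq_zero.1 (ZMod.injective_stdAddChar e))
  have hxq : ZMod.stdAddChar (-h) ^ q = 1 := by
    rw [← AddChar.map_nsmul_eq_pow]; simp
  have hgeom : ∑ k ∈ range q, ZMod.stdAddChar (-h) ^ k = 0 := by
    rw [geom_sum_eq hx1, hxq]; simp
  have hsum : ZMod.dft (fun z : ZMod q => (z.val : ℂ) / q) h =
      (∑ k ∈ range q, (k : ℂ) * ZMod.stdAddChar (-h) ^ k) / q := by
    rw [ZMod.dft_apply, sum_div]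
    refine sum_bij' (fun z _ => z.val) (fun k _ => (k : ZMod q)) ?_ ?_ ?_ ?_ ?_
    · intro z _; exact mem_range.2 z.val_lt
    · simp
    · intro z _; simp
    · intro k hk; exact ZMod.val_cast_of_lt (mem_range.1 hk)
    · intro z _
      rw [← AddChar.map_nsmul_eq_pow, nsmul_eq_mul, ZMod.natCast_zmod_val, smul_eq_mul,
        mul_neg]
      ring
  have hprod := sum_range_mul_pow (ZMod.stdAddChar (-h)) q
  rw [hxq, hgeom, mul_zero, sub_zero, mul_one] at hprod
  have hval : ZMod.dft (fun z : ZMod q => (z.val : ℂ) / q) h =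
      (ZMod.stdAddChar (-h) - 1)⁻¹ := by
    rw [hsum]
    refine eq_inv_of_mul_eq_one_right ?_
    rw [mul_div_assoc', hprod, div_self hqc]
  have hm : (0 : ℝ) < h.valMinAbs.natAbs := by
    have : h.valMinAbs.natAbs ≠ 0 := by simpa using hh
    exact_mod_cast Nat.pos_of_ne_zero this
  have := le_norm_stdAddChar_sub_one (-h)
  rw [ZMod.natAbs_valMinAbs_neg] at this
  rw [hval, norm_inv, ← inv_div]
  exact inv_anti₀ (by positivity) this

/-- Sums over nonzero residues of a function of the distance to zero. -/
lemma sum_natAbs_valMinAbs_le {q : ℕ} [NeZero q] (φ : ℕ → ℝ) (hφ : ∀ n, 0 ≤ φ n) :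
    ∑ h ∈ univ.erase (0 : ZMod q), φ h.valMinAbs.natAbs ≤ 2 * ∑ n ∈ Icc 1 q, φ n := by
  have hmaps : ∀ h ∈ univ.erase (0 : ZMod q), h.valMinAbs.natAbs ∈ Icc 1 q := by
    intro h hh
    have h0 : h.valMinAbs.natAbs ≠ 0 := by simpa using ne_of_mem_erase hh
    have := ZMod.natAbs_valMinAbs_le h
    rw [mem_Icc]
    omega
  rw [← sum_fiberwise_of_maps_to hmaps, mul_sum]
  refine sum_le_sum fun n _ => ?_
  rw [sum_congr rfl (g := fun _ => φ n) (fun h hh => by rw [(mem_filter.1 hh).2]), sum_const,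
    nsmul_eq_mul]
  refine mul_le_mul_of_nonneg_right ?_ (hφ n)
  have : #{h ∈ univ.erase (0 : ZMod q) | h.valMinAbs.natAbs = n} ≤
      #({(n : ZMod q), -(n : ZMod q)} : Finset (ZMod q)) := by
    refine card_le_card fun h hh => ?_
    have hn := (mem_filter.1 hh).2
    have hv := ZMod.coe_valMinAbs h
    rw [mem_insert, mem_singleton]
    rcases Int.natAbs_eq h.valMinAbs with e | e <;> rw [e, hn] at hv <;> push_cast at hv
    · exact Or.inl hv.symm
    · exact Or.inr hv.symm
  exact_mod_cast this.trans card_le_two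

lemma card_divisors_le_two_mul_sqrt (q : ℕ) : (#q.divisors : ℝ) ≤ 2 * Real.sqrt q := by
  have hsub : q.divisors ⊆ Icc 1 q.sqrt ∪ (Icc 1 q.sqrt).image (fun d => q / d) := by
    intro d hd
    obtain ⟨⟨e, rfl⟩, h0⟩ := Nat.mem_divisors.1 hd
    have hd0 : 0 < d := Nat.pos_of_ne_zero (left_ne_zero_of_mul h0)
    have he0 : 0 < e := Nat.pos_of_ne_zero (right_ne_zero_of_mul h0)
    rw [mem_union, mem_image]
    rcases le_total d e with h | h
    · exact Or.inl (mem_Icc.2 ⟨hd0, Nat.le_sqrt.2 (Nat.mul_le_mul_left d h)⟩)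
    · exact Or.inr ⟨e, mem_Icc.2 ⟨he0, Nat.le_sqrt.2 (Nat.mul_le_mul_right e h)⟩,
        Nat.mul_div_cancel d he0⟩
  have h1 : #q.divisors ≤ q.sqrt + q.sqrt := by
    refine (card_le_card hsub).trans ((card_union_le _ _).trans (add_le_add (by simp) ?_))
    exact card_image_le.trans (by simp)
  have h2 : ((q.sqrt : ℕ) : ℝ) ≤ Real.sqrt q := Real.nat_sqrt_le_real_sqrt
  have h3 : (#q.divisors : ℝ) ≤ q.sqrt + q.sqrt := by exact_mod_cast h1
  linarith

lemma sum_gcd_div_le {q : ℕ} (hq : q ≠ 0) :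
    ∑ n ∈ Icc 1 q, (Nat.gcd n q : ℝ) / n ≤ #q.divisors * ∑ n ∈ Icc 1 q, (n : ℝ)⁻¹ := by
  calc ∑ n ∈ Icc 1 q, (Nat.gcd n q : ℝ) / n
      ≤ ∑ n ∈ Icc 1 q, ∑ d ∈ q.divisors, if d ∣ n then (d : ℝ) / n else 0 := by
        refine sum_le_sum fun n _ => ?_
        refine le_trans (le_of_eq ?_) (single_le_sum
          (f := fun d : ℕ => if d ∣ n then (d : ℝ) / n else 0)
          (fun d _ => by positivity) (Nat.mem_divisors.2 ⟨Nat.gcd_dvd_right n q, hq⟩))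
        rw [if_pos (Nat.gcd_dvd_left n q)]
    _ = ∑ d ∈ q.divisors, ∑ n ∈ Icc 1 q with d ∣ n, (d : ℝ) / n := by
        rw [sum_comm]
        simp_rw [sum_filter]
    _ ≤ ∑ d ∈ q.divisors, ∑ n ∈ Icc 1 q, (n : ℝ)⁻¹ := by
        refine sum_le_sum fun d hd => ?_
        have hd0 : 0 < d := Nat.pos_of_mem_divisors hd
        have hd0' : (d : ℝ) ≠ 0 := by exact_mod_cast hd0.ne'
        calc ∑ n ∈ Icc 1 q with d ∣ n, (d : ℝ) / n
            ≤ ∑ n ∈ (Icc 1 q).image (fun m => d * m), (d : ℝ) / n := by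
              refine sum_le_sum_of_subset_of_nonneg ?_ fun _ _ _ => by positivity
              intro n hn
              obtain ⟨hn, m, rfl⟩ := mem_filter.1 hn
              rw [mem_Icc] at hn
              refine mem_image.2 ⟨m, mem_Icc.2 ⟨Nat.pos_of_mul_pos_left hn.1, ?_⟩, rfl⟩
              exact (Nat.le_mul_of_pos_left m hd0).trans hn.2
          _ = ∑ n ∈ Icc 1 q, (n : ℝ)⁻¹ := by
              rw [sum_image fun a _ b _ h => Nat.eq_of_mul_eq_mul_left hd0 h]
              refine sum_congr rfl fun m _ => ?_
              push_cast
              rw [div_mul_eq_div_div, div_self hd0', one_div]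
    _ = _ := by rw [sum_const, nsmul_eq_mul]

lemma sum_inv_le_rpow {q : ℕ} (hq : 1 ≤ q) :
    ∑ n ∈ Icc 1 q, (n : ℝ)⁻¹ ≤ 9 * (q : ℝ) ^ (1 / 8 : ℝ) := by
  have h := harmonic_le_one_add_log q
  rw [harmonic_eq_sum_Icc] at h
  push_cast at h
  have h2 := Real.log_le_rpow_div (Nat.cast_nonneg (α := ℝ) q) (by norm_num : (0 : ℝ) < 1 / 8)
  have h3 : (1 : ℝ) ≤ (q : ℝ) ^ (1 / 8 : ℝ) :=
    Real.one_le_rpow (by exact_mod_cast hq) (by norm_num)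
  linarith

lemma sum_sqrt_gcd_div_le {q : ℕ} (hq : 1 ≤ q) :
    ∑ n ∈ Icc 1 q, Real.sqrt (Nat.gcd (2 * n) q) / n ≤ 23 * (q : ℝ) ^ (3 / 8 : ℝ) := by
  have hq0 : (0 : ℝ) < q := by exact_mod_cast hq
  set r : ℝ := (q : ℝ) ^ (1 / 4 : ℝ) with hr
  have hr0 : 0 < r := Real.rpow_pos_of_pos hq0 _
  have hrr : Real.sqrt q = r * r := by
    rw [hr, ← Real.rpow_add hq0, Real.sqrt_eq_rpow]; norm_num
  have hterm : ∀ n ∈ Icc 1 q, Real.sqrt (Nat.gcd (2 * n) q) / n ≤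
      r / 2 * (n : ℝ)⁻¹ + r⁻¹ * ((Nat.gcd n q : ℝ) / n) := by
    intro n _
    have hg : (Nat.gcd (2 * n) q : ℝ) ≤ 2 * Nat.gcd n q := by
      have h1 : Nat.gcd (2 * n) q ≤ Nat.gcd 2 q * Nat.gcd n q := by
        refine Nat.le_of_dvd ?_ (Nat.gcd_mul_left_dvd_mul_gcd q 2 n)
        exact Nat.mul_pos (Nat.gcd_pos_of_pos_right _ hq) (Nat.gcd_pos_of_pos_right _ hq)
      have h2 : Nat.gcd 2 q ≤ 2 := Nat.gcd_le_left q two_pos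
      exact_mod_cast h1.trans (Nat.mul_le_mul_right _ h2)
    have hs := Real.sq_sqrt (Nat.cast_nonneg (α := ℝ) (Nat.gcd (2 * n) q))
    have : Real.sqrt (Nat.gcd (2 * n) q) ≤ r / 2 + r⁻¹ * Nat.gcd n q := by
      rw [← sub_nonneg]
      have : r / 2 + r⁻¹ * Nat.gcd n q - Real.sqrt (Nat.gcd (2 * n) q) =
          ((r - Real.sqrt (Nat.gcd (2 * n) q)) ^ 2 +
            (2 * Nat.gcd n q - Real.sqrt (Nat.gcd (2 * n) q) ^ 2)) / (2 * r) := by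
        field_simp
        ring
      rw [this]
      have := sq_nonneg (r - Real.sqrt (Nat.gcd (2 * n) q))
      refine div_nonneg ?_ (by positivity)
      linarith
    calc _ ≤ (r / 2 + r⁻¹ * Nat.gcd n q) / n := by gcongr
      _ = _ := by ring
  refine (sum_le_sum hterm).trans ?_
  rw [sum_add_distrib, ← mul_sum, ← mul_sum]
  have h1 := sum_inv_le_rpow hq
  have h0 : 0 ≤ ∑ n ∈ Icc 1 q, (n : ℝ)⁻¹ := by positivity
  have h2 : r⁻¹ * ∑ n ∈ Icc 1 q, (Nat.gcd n q : ℝ) / n ≤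
      r⁻¹ * (2 * (r * r) * ∑ n ∈ Icc 1 q, (n : ℝ)⁻¹) := by
    gcongr
    refine (sum_gcd_div_le (by omega)).trans ?_
    gcongr
    rw [← hrr]
    exact card_divisors_le_two_mul_sqrt q
  have h3 : r⁻¹ * (2 * (r * r) * ∑ n ∈ Icc 1 q, (n : ℝ)⁻¹) =
      2 * (r * ∑ n ∈ Icc 1 q, (n : ℝ)⁻¹) := by
    field_simp
  have h4 : r * ∑ n ∈ Icc 1 q, (n : ℝ)⁻¹ ≤ 9 * (q : ℝ) ^ (3 / 8 : ℝ) := by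
    calc _ ≤ r * (9 * (q : ℝ) ^ (1 / 8 : ℝ)) := by gcongr
      _ = 9 * (r * (q : ℝ) ^ (1 / 8 : ℝ)) := by ring
      _ = _ := by rw [hr, ← Real.rpow_add hq0]; norm_num
  have h5 : (0 : ℝ) ≤ (q : ℝ) ^ (3 / 8 : ℝ) := by positivity
  linarith

/-- Equidistribution of shifted squares modulo `q`, tested against `z ↦ z / q`. -/
lemma abs_sum_val_sub_sq_sub_le {q : ℕ} [NeZero q] (a : ZMod q) :
    |∑ i : ZMod q, ((a - i ^ 2).val : ℝ) / q - ∑ z : ZMod q, (z.val : ℝ) / q| ≤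
      12 * (q : ℝ) ^ (7 / 8 : ℝ) := by
  have hq0 : (0 : ℝ) < q := by exact_mod_cast NeZero.pos q
  have hqc : (q : ℂ) ≠ 0 := by exact_mod_cast hq0.ne'
  set s : ZMod q → ℂ := fun z => (z.val : ℂ) / q with hs
  have hinv : ∀ z, s z = (q : ℂ)⁻¹ * ∑ h, ZMod.stdAddChar (h * z) * ZMod.dft s h := by
    intro z
    conv_lhs => rw [← LinearEquiv.symm_apply_apply ZMod.dft s, ZMod.invDFT_apply]
    simp only [smul_eq_mul]
  have hkey : ∑ i : ZMod q, s (a - i ^ 2) - ∑ z, s z =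
      (q : ℂ)⁻¹ * ∑ h ∈ univ.erase (0 : ZMod q), ZMod.stdAddChar (h * a) * ZMod.dft s h *
        ∑ i : ZMod q, ZMod.stdAddChar (-h * i ^ 2) := by
    have h1 : ∑ i : ZMod q, s (a - i ^ 2) =
        (q : ℂ)⁻¹ * ∑ h, ZMod.stdAddChar (h * a) * ZMod.dft s h *
          ∑ i : ZMod q, ZMod.stdAddChar (-h * i ^ 2) := by
      simp_rw [hinv (a - _ ^ 2), ← mul_sum]
      rw [sum_comm]
      congr 1
      refine sum_congr rfl fun h _ => ?_
      rw [mul_sum]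
      refine sum_congr rfl fun i _ => ?_
      rw [mul_sub, sub_eq_add_neg, AddChar.map_add_eq_mul, ← neg_mul]
      ring
    rw [h1, ← add_sum_erase _ _ (mem_univ (0 : ZMod q)), mul_add, ZMod.dft_apply_zero]
    simp [ZMod.card]
    field_simp
    ring
  have hnorm : |∑ i : ZMod q, ((a - i ^ 2).val : ℝ) / q - ∑ z : ZMod q, (z.val : ℝ) / q| =
      ‖∑ i : ZMod q, s (a - i ^ 2) - ∑ z, s z‖ := by
    rw [← Real.norm_eq_abs, ← Complex.norm_real]
    push_cast
    rfl
  rw [hnorm, hkey, norm_mul, norm_inv, Complex.norm_natCast]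
  have hterm : ∀ h ∈ univ.erase (0 : ZMod q), ‖ZMod.stdAddChar (h * a) * ZMod.dft s h *
        ∑ i : ZMod q, ZMod.stdAddChar (-h * i ^ 2)‖ ≤
      (q * Real.sqrt q / 4) *
        (Real.sqrt (Nat.gcd (2 * h.valMinAbs.natAbs) q) / h.valMinAbs.natAbs) := by
    intro h hh
    rw [norm_mul, norm_mul, AddChar.norm_apply, one_mul]
    have hG : ‖∑ i : ZMod q, ZMod.stdAddChar (-h * i ^ 2)‖ ≤
        Real.sqrt q * Real.sqrt (Nat.gcd (2 * h.valMinAbs.natAbs) q) := by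
      rw [← Real.sqrt_mul hq0.le]
      refine Real.le_sqrt_of_sq_le ((norm_sq_gaussSum_le (-h)).trans ?_)
      gcongr
      have := card_two_mul_mul_eq_zero_le (-h)
      rwa [ZMod.natAbs_valMinAbs_neg] at this
    refine (mul_le_mul (norm_dft_val_le (ne_of_mem_erase hh)) hG (norm_nonneg _)
      (by positivity)).trans (le_of_eq ?_)
    ring
  have hsum := (norm_sum_le _ _).trans (sum_le_sum hterm)
  rw [← mul_sum] at hsum
  have h2 := (sum_natAbs_valMinAbs_le (q := q)
    (fun n => Real.sqrt (Nat.gcd (2 * n) q) / n) (fun n => by positivity)).trans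
    (mul_le_mul_of_nonneg_left (sum_sqrt_gcd_div_le (NeZero.pos q)) two_pos.le)
  calc _ ≤ (q : ℝ)⁻¹ * ((q * Real.sqrt q / 4) * (2 * (23 * (q : ℝ) ^ (3 / 8 : ℝ)))) := by
        gcongr
        exact hsum.trans (by gcongr)
    _ = 23 / 2 * (Real.sqrt q * (q : ℝ) ^ (3 / 8 : ℝ)) := by field_simp; ring
    _ = 23 / 2 * (q : ℝ) ^ (7 / 8 : ℝ) := by
        rw [Real.sqrt_eq_rpow, ← Real.rpow_add hq0]; norm_num
    _ ≤ _ := by gcongr; norm_num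

/-- The sawtooth function `ψ(x) = x - ⌊x⌋ - 1/2`. -/
noncomputable def sawtooth (x : ℝ) : ℝ := Int.fract x - 1 / 2

lemma abs_sawtooth_le (x : ℝ) : |sawtooth x| ≤ 1 / 2 := by
  have h1 := Int.fract_nonneg x
  have h2 := Int.fract_lt_one x
  rw [sawtooth, abs_le]
  constructor <;> linarith

lemma fract_intCast_add_div {q : ℕ} [NeZero q] (a : ℤ) {θ : ℝ} (h0 : 0 ≤ θ) (h1 : θ < 1) :
    Int.fract ((a + θ) / q) = ((a : ZMod q).val : ℝ) / q + θ / q := by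
  have hq0 : (0 : ℝ) < q := by exact_mod_cast NeZero.pos q
  rw [Int.fract_eq_iff]
  refine ⟨by positivity, ?_, a / q, ?_⟩
  · rw [← add_div, div_lt_one hq0]
    have h : (a : ZMod q).val + 1 ≤ q := (a : ZMod q).val_lt
    have : ((a : ZMod q).val : ℝ) + 1 ≤ q := by exact_mod_cast h
    linarith
  · have h : ((a : ZMod q).val : ℤ) = a % q := ZMod.val_intCast a
    have h2 : (((a : ZMod q).val : ℤ) : ℝ) = a - q * (a / q : ℤ) := by
      rw [h, Int.emod_def]; push_cast; rfl
    rw [Int.cast_natCast] at h2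
    rw [h2]
    field_simp
    ring

lemma sum_range_natCast_zmod {q : ℕ} [NeZero q] (g : ZMod q → ℝ) :
    ∑ i ∈ range q, g i = ∑ z, g z := by
  refine sum_bij' (fun k _ => (k : ZMod q)) (fun z _ => z.val) ?_ ?_ ?_ ?_ ?_
  · simp
  · intro z _; exact mem_range.2 z.val_lt
  · intro k hk; exact ZMod.val_cast_of_lt (mem_range.1 hk)
  · intro z _; simp
  · simp

lemma abs_sum_range_natCast_zmod_le {q : ℕ} [NeZero q] (g : ZMod q → ℝ) (hg : ∀ z, |g z| ≤ 1)
    (n : ℕ) : |∑ i ∈ range n, g i| ≤ n / q * |∑ z, g z| + q := by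
  have hq : 0 < q := NeZero.pos q
  have hblocks : ∀ b : ℕ, ∑ i ∈ range (q * b), g i = b * ∑ z, g z := by
    intro b
    induction b with
    | zero => simp
    | succ b ih =>
      rw [Nat.mul_succ, sum_range_add, ih, ← sum_range_natCast_zmod g]
      simp
      ring
  have hrest : |∑ i ∈ range (n % q), g i| ≤ q := by
    refine (abs_sum_le_sum_abs _ _).trans ((sum_le_sum fun i _ => hg _).trans ?_)
    simpa using (Nat.mod_lt n hq).le
  have hsplit : ∑ i ∈ range n, g i =
      ((n / q : ℕ) : ℝ) * ∑ z, g z + ∑ i ∈ range (n % q), g i := by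
    conv_lhs => rw [← Nat.div_add_mod n q, sum_range_add, hblocks]
    simp
  rw [hsplit]
  refine (abs_add_le _ _).trans (add_le_add ?_ hrest)
  rw [abs_mul, Nat.abs_cast]
  gcongr
  exact Nat.cast_div_le

/-- Complete residue systems: sawtooth sums over a quadratic with modulus small compared to the
length. -/
lemma abs_sum_sawtooth_le_of_period {q : ℕ} (hq : 1 ≤ q) (x : ℝ) (n : ℕ) :
    |∑ i ∈ range n, sawtooth ((x - ((i : ℝ) + 1) ^ 2) / q)| ≤
      13 * n * (q : ℝ) ^ (-1 / 8 : ℝ) + q := by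
  have : NeZero q := ⟨by omega⟩
  have hq0 : (0 : ℝ) < q := by exact_mod_cast hq
  set g : ZMod q → ℝ := fun z =>
    (((⌊x⌋ : ZMod q) - (z + 1) ^ 2).val : ℝ) / q + Int.fract x / q - 1 / 2 with hg
  have hval : ∀ i : ℕ, sawtooth ((x - ((i : ℝ) + 1) ^ 2) / q) = g i := by
    intro i
    have h := fract_intCast_add_div (q := q) (⌊x⌋ - ((i : ℤ) + 1) ^ 2) (Int.fract_nonneg x)
      (Int.fract_lt_one x)
    have e : x - ((i : ℝ) + 1) ^ 2 =
        ((⌊x⌋ - ((i : ℤ) + 1) ^ 2 : ℤ) : ℝ) + Int.fract x := by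
      push_cast
      linear_combination -(Int.floor_add_fract x)
    rw [sawtooth, e, h, hg]
    push_cast
    rfl
  have hg1 : ∀ z, |g z| ≤ 1 := by
    intro z
    have h := abs_sawtooth_le ((x - ((z.val : ℝ) + 1) ^ 2) / q)
    rw [hval, ZMod.natCast_zmod_val] at h
    linarith
  have hS : |∑ z, g z| ≤ 13 * (q : ℝ) ^ (7 / 8 : ℝ) := by
    have hid : ∑ z : ZMod q, (z.val : ℝ) / q = (q - 1) / 2 := by
      rw [← sum_range_natCast_zmod, ← sum_div, sum_congr rfl
        (g := fun i : ℕ => (i : ℝ)) (fun i hi => by rw [ZMod.val_cast_of_lt (mem_range.1 hi)])]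
      have := sum_range_id_mul_two q
      have h2 : (∑ i ∈ range q, (i : ℝ)) * 2 = q * (q - 1) := by
        rw [← Nat.cast_pred hq, ← Nat.cast_sum]; exact_mod_cast this
      field_simp
      linarith
    have hE := abs_sum_val_sub_sq_sub_le (q := q) (⌊x⌋ : ZMod q)
    have hsum : ∑ z, g z = (∑ i : ZMod q, (((⌊x⌋ : ZMod q) - i ^ 2).val : ℝ) / q -
        ∑ z : ZMod q, (z.val : ℝ) / q) + (Int.fract x - 1 / 2) := by
      rw [hid, ← Equiv.sum_comp (Equiv.addRight (1 : ZMod q))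
        (fun i => (((⌊x⌋ : ZMod q) - i ^ 2).val : ℝ) / q)]
      simp only [hg, sum_sub_distrib, sum_add_distrib, Equiv.coe_addRight, sum_const, card_univ,
        ZMod.card, nsmul_eq_mul]
      field_simp
      ring
    have h1 : (1 : ℝ) ≤ (q : ℝ) ^ (7 / 8 : ℝ) :=
      Real.one_le_rpow (by exact_mod_cast hq) (by norm_num)
    rw [hsum]
    refine (abs_add_le _ _).trans ?_
    have := abs_sawtooth_le x
    rw [sawtooth] at this
    linarith
  simp_rw [hval]
  refine (abs_sum_range_natCast_zmod_le g hg1 n).trans ?_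
  refine add_le_add_left ?_ _
  calc (n : ℝ) / q * |∑ z, g z| ≤ (n : ℝ) / q * (13 * (q : ℝ) ^ (7 / 8 : ℝ)) := by gcongr
    _ = 13 * n * ((q : ℝ) ^ (7 / 8 : ℝ) / (q : ℝ) ^ (1 : ℝ)) := by rw [Real.rpow_one]; ring
    _ = 13 * n * (q : ℝ) ^ (-1 / 8 : ℝ) := by rw [← Real.rpow_sub hq0]; norm_num

lemma sum_mul_eq_by_parts (w d : ℕ → ℝ) (n : ℕ) :
    ∑ i ∈ range n, w i * d i = w n * ∑ i ∈ range n, d i +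
      ∑ i ∈ range n, (w i - w (i + 1)) * ∑ j ∈ range (i + 1), d j := by
  induction n with
  | zero => simp
  | succ n ih =>
    rw [sum_range_succ, ih, sum_range_succ (fun i => (w i - w (i + 1)) * _),
      sum_range_succ d n]
    ring

lemma abs_sum_antitone_mul_le {w d : ℕ → ℝ} {M : ℝ} {n : ℕ} (hw : Antitone w)
    (hw0 : ∀ i, 0 ≤ w i) (hd : ∀ k ≤ n, |∑ i ∈ range k, d i| ≤ M) :
    |∑ i ∈ range n, w i * d i| ≤ w 0 * M := by
  rw [sum_mul_eq_by_parts]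
  have h2 : |∑ i ∈ range n, (w i - w (i + 1)) * ∑ j ∈ range (i + 1), d j| ≤
      ∑ i ∈ range n, (w i - w (i + 1)) * M := by
    refine (abs_sum_le_sum_abs _ _).trans (sum_le_sum fun i hi => ?_)
    have hi' : 0 ≤ w i - w (i + 1) := sub_nonneg.2 (hw (Nat.le_succ i))
    rw [abs_mul, abs_of_nonneg hi']
    exact mul_le_mul_of_nonneg_left (hd _ (mem_range.1 hi)) hi'
  rw [← sum_mul, sum_range_sub'] at h2
  have h1 : |w n * ∑ i ∈ range n, d i| ≤ w n * M := by
    rw [abs_mul, abs_of_nonneg (hw0 n)]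
    exact mul_le_mul_of_nonneg_left (hd _ le_rfl) (hw0 n)
  refine (abs_add_le _ _).trans ((add_le_add h1 h2).trans (le_of_eq ?_))
  ring

lemma abs_sum_monotone_mul_le {w d : ℕ → ℝ} {M : ℝ} {n : ℕ} (hw : Monotone w)
    (hw0 : ∀ i, 0 ≤ w i) (hd : ∀ k ≤ n, |∑ i ∈ range k, d i| ≤ M) :
    |∑ i ∈ range n, w i * d i| ≤ 2 * w n * M := by
  have hM : 0 ≤ M := (abs_nonneg _).trans (hd 0 n.zero_le)
  rw [sum_mul_eq_by_parts]
  have h2 : |∑ i ∈ range n, (w i - w (i + 1)) * ∑ j ∈ range (i + 1), d j| ≤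
      ∑ i ∈ range n, (w (i + 1) - w i) * M := by
    refine (abs_sum_le_sum_abs _ _).trans (sum_le_sum fun i hi => ?_)
    have hi' : 0 ≤ w (i + 1) - w i := sub_nonneg.2 (hw (Nat.le_succ i))
    rw [abs_mul, abs_sub_comm, abs_of_nonneg hi']
    exact mul_le_mul_of_nonneg_left (hd _ (mem_range.1 hi)) hi'
  rw [← sum_mul, sum_range_sub] at h2
  have h1 : |w n * ∑ i ∈ range n, d i| ≤ w n * M := by
    rw [abs_mul, abs_of_nonneg (hw0 n)]
    exact mul_le_mul_of_nonneg_left (hd _ le_rfl) (hw0 n)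
  have h3 := mul_nonneg (hw0 0) hM
  refine (abs_add_le _ _).trans ((add_le_add h1 h2).trans ?_)
  linarith

/-- The sawtooth is a difference quotient of its primitive `ψ² / 2`, up to the step size and the
number of integers crossed. -/
lemma abs_sawtooth_add_div_le (u : ℝ) {δ : ℝ} (hδ : 0 < δ) :
    |sawtooth u + (sawtooth (u - δ) ^ 2 / 2 - sawtooth u ^ 2 / 2) / δ| ≤
      δ / 2 + (⌊u⌋ - ⌊u - δ⌋ : ℝ) := by
  have ha0 := Int.fract_nonneg u
  have ha1 := Int.fract_lt_one u
  have hb0 := Int.fract_nonneg (u - δ)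
  have hb1 := Int.fract_lt_one (u - δ)
  have hu := Int.floor_add_fract u
  have hv := Int.floor_add_fract (u - δ)
  obtain ⟨p, hp⟩ : ∃ p : ℕ, ⌊u⌋ - ⌊u - δ⌋ = p :=
    Int.eq_ofNat_of_zero_le (sub_nonneg.2 (Int.floor_le_floor (by linarith)))
  have hp' : (⌊u⌋ - ⌊u - δ⌋ : ℝ) = p := by exact_mod_cast hp
  rw [hp']
  unfold sawtooth
  generalize Int.fract u = a at *
  generalize Int.fract (u - δ) = b at *
  have hd : δ = a - b + p := by linarith
  have hmul : |(a - 1 / 2) * δ + ((b - 1 / 2) ^ 2 / 2 - (a - 1 / 2) ^ 2 / 2)| ≤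
      (δ / 2 + p) * δ := by
    have hid : (a - 1 / 2) * δ + ((b - 1 / 2) ^ 2 / 2 - (a - 1 / 2) ^ 2 / 2) =
        δ ^ 2 / 2 - δ * p + p * (p - 1) / 2 + a * p := by
      rw [hd]; ring
    rw [hid]
    rcases Nat.eq_zero_or_pos p with h0 | h0
    · subst h0
      rw [abs_le]
      constructor <;> push_cast <;> nlinarith
    · have h1 : (1 : ℝ) ≤ p := by exact_mod_cast h0
      have h2 : 0 ≤ (p : ℝ) * (p - 1) := mul_nonneg (by linarith) (by linarith)
      have h3 : 0 ≤ a * p := by positivity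
      have h4 : 0 ≤ (p : ℝ) * (δ - (p - 1)) := mul_nonneg (by linarith) (by linarith)
      have h5 : 0 ≤ (p : ℝ) * (δ - a) := mul_nonneg (by linarith) (by linarith)
      rw [abs_le]
      constructor <;> nlinarith
  have heq : a - 1 / 2 + ((b - 1 / 2) ^ 2 / 2 - (a - 1 / 2) ^ 2 / 2) / δ =
      ((a - 1 / 2) * δ + ((b - 1 / 2) ^ 2 / 2 - (a - 1 / 2) ^ 2 / 2)) / δ := by
    field_simp
  rw [heq, abs_div, abs_of_pos hδ, div_le_iff₀ hδ]
  exact hmul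

lemma abs_sum_sawtooth_shift_le (t : ℝ) {q : ℝ} (hq : 0 < q) (a n : ℕ) :
    |∑ l ∈ range n, sawtooth ((t - ((a + l : ℕ) + 1 : ℝ) ^ 2) / q)| ≤
      q / (2 * a + 3) / 8 + 3 / 2 * ((a + n : ℕ) + 1 : ℝ) ^ 2 / q + 1 := by
  set u : ℕ → ℝ := fun l => (t - ((a + l : ℕ) + 1 : ℝ) ^ 2) / q with hu
  set w : ℕ → ℝ := fun l => q / (2 * (a + l : ℕ) + 3) with hw
  set P : ℕ → ℝ := fun l => sawtooth (u l) ^ 2 / 2 with hP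
  have hP0 : ∀ l, 0 ≤ P l ∧ P l ≤ 1 / 8 := by
    intro l
    have h := abs_le.1 (abs_sawtooth_le (u l))
    constructor
    · positivity
    · simp only [hP]; nlinarith
  have hstep : ∀ l, u (l + 1) = u l - (w l)⁻¹ := by
    intro l
    simp only [hu, hw]
    push_cast
    field_simp
    ring
  have hw0 : ∀ l, 0 < w l := fun l => by simp only [hw]; positivity
  have hanti : Antitone w := by
    intro i j hij
    simp only [hw]
    gcongr
  have habel := abs_sum_antitone_mul_le (d := fun l => P (l + 1) - P l) (n := n) (M := 1 / 8)
    hanti (fun l => (hw0 l).le) (fun k _ => by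
      rw [sum_range_sub, abs_le]
      have h1 := hP0 k
      have h2 := hP0 0
      constructor <;> linarith)
  have herr : |∑ l ∈ range n, (sawtooth (u l) + w l * (P (l + 1) - P l))| ≤
      ∑ l ∈ range n, ((u l - u (l + 1)) / 2 + ((⌊u l⌋ : ℝ) - ⌊u (l + 1)⌋)) := by
    refine (abs_sum_le_sum_abs _ _).trans (sum_le_sum fun l _ => ?_)
    have h := abs_sawtooth_add_div_le (u l) (inv_pos.2 (hw0 l))
    rw [← hstep, div_inv_eq_mul, mul_comm _ (w l)] at h
    refine h.trans (le_of_eq ?_)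
    rw [hstep]
    ring
  rw [sum_add_distrib, sum_add_distrib, ← sum_div, sum_range_sub',
    sum_range_sub' (fun l => (⌊u l⌋ : ℝ))] at herr
  have hfl : (⌊u 0⌋ : ℝ) - ⌊u n⌋ ≤ u 0 - u n + 1 := by
    have h1 := Int.floor_le (u 0)
    have h2 := Int.lt_floor_add_one (u n)
    linarith
  have hun : u 0 - u n ≤ ((a + n : ℕ) + 1 : ℝ) ^ 2 / q := by
    simp only [hu]
    rw [← sub_div]
    gcongr
    have : 0 ≤ ((a + 0 : ℕ) + 1 : ℝ) ^ 2 := by positivity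
    linarith
  have hsplit : ∑ l ∈ range n, sawtooth (u l) =
      (∑ l ∈ range n, sawtooth (u l) + ∑ l ∈ range n, w l * (P (l + 1) - P l)) -
        ∑ l ∈ range n, w l * (P (l + 1) - P l) := by ring
  have hw00 : w 0 = q / (2 * a + 3) := by simp [hw]
  rw [hsplit]
  refine (abs_sub _ _).trans ?_
  rw [hw00] at habel
  have : 3 / 2 * ((a + n : ℕ) + 1 : ℝ) ^ 2 / q = 3 / 2 * (((a + n : ℕ) + 1 : ℝ) ^ 2 / q) := by ring
  rw [this]
  linarith

/-- Short sums: sawtooth sums over a quadratic with slowly varying values. -/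
lemma abs_sum_sawtooth_le_of_slow (t : ℝ) {q : ℝ} (hq : 0 < q) (n : ℕ) :
    |∑ i ∈ range n, sawtooth ((t - ((i : ℝ) + 1) ^ 2) / q)| ≤
      Real.sqrt q + 3 / 2 * ((n : ℝ) + 1) ^ 2 / q + 1 := by
  have htriv : ∀ k : ℕ, |∑ i ∈ range k, sawtooth ((t - ((i : ℝ) + 1) ^ 2) / q)| ≤ k / 2 := by
    intro k
    refine (abs_sum_le_sum_abs _ _).trans ((sum_le_sum fun i _ => abs_sawtooth_le _).trans ?_)
    simp
    linarith
  set a := ⌊Real.sqrt q⌋₊ with ha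
  have ha1 : (a : ℝ) ≤ Real.sqrt q := Nat.floor_le (Real.sqrt_nonneg q)
  have ha2 : Real.sqrt q < a + 1 := Nat.lt_floor_add_one _
  have hs : 0 ≤ Real.sqrt q := Real.sqrt_nonneg q
  rcases le_total n a with h | h
  · have h' : (n : ℝ) ≤ a := by exact_mod_cast h
    have : 0 ≤ 3 / 2 * ((n : ℝ) + 1) ^ 2 / q := by positivity
    linarith [htriv n]
  · obtain ⟨l, rfl⟩ := Nat.exists_eq_add_of_le h
    rw [sum_range_add]
    refine (abs_add_le _ _).trans ?_
    have h1 := abs_sum_sawtooth_shift_le t hq a l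
    have h2 := htriv a
    have h3 : q / (2 * a + 3) ≤ Real.sqrt q := by
      rw [div_le_iff₀ (by positivity)]
      nlinarith [Real.mul_self_sqrt hq.le]
    linarith

/-- The logarithmically weighted sawtooth sum `D(t) = ∑_{k ≤ t} ψ(t / k) / k`. -/
noncomputable def sawtoothSum (t : ℝ) : ℝ :=
  ∑ k ∈ Icc 1 ⌊t⌋₊, (k : ℝ)⁻¹ * sawtooth (t / k)

lemma sum_sawtoothSum_sub_sq {t : ℝ} {c n : ℕ} (hc : 1 ≤ c) (hn : (n : ℝ) ≤ Real.sqrt t) :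
    ∑ i ∈ range n, sawtoothSum ((t - ((i : ℝ) + 1) ^ 2) / c) =
      ∑ k ∈ Icc 1 ⌊t⌋₊, (k : ℝ)⁻¹ * ∑ i ∈ range (min n ⌊Real.sqrt (t - (c * k : ℕ))⌋₊),
        sawtooth ((t - ((i : ℝ) + 1) ^ 2) / (c * k : ℕ)) := by
  have hc0 : (0 : ℝ) < c := by exact_mod_cast hc
  have hc1 : (1 : ℝ) ≤ c := by exact_mod_cast hc
  have h1 : ∀ i ∈ range n, sawtoothSum ((t - ((i : ℝ) + 1) ^ 2) / c) =
      ∑ k ∈ Icc 1 ⌊t⌋₊, if i < ⌊Real.sqrt (t - (c * k : ℕ))⌋₊ then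
        (k : ℝ)⁻¹ * sawtooth ((t - ((i : ℝ) + 1) ^ 2) / (c * k : ℕ)) else 0 := by
    intro i hi
    have hiff : ∀ k : ℕ, k ≠ 0 → (i < ⌊Real.sqrt (t - (c * k : ℕ))⌋₊ ↔
        k ≤ ⌊(t - ((i : ℝ) + 1) ^ 2) / c⌋₊) := by
      intro k hk
      rw [← Nat.succ_le_iff, Nat.le_floor_iff' (Nat.succ_ne_zero i), Nat.le_floor_iff' hk,
        Real.le_sqrt' (by positivity), le_div_iff₀ hc0]
      push_cast
      constructor <;> intro h <;> linarith
    rw [sawtoothSum, ← sum_filter]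
    refine sum_congr ?_ fun k _ => ?_
    · ext k
      rw [mem_filter, mem_Icc, mem_Icc]
      constructor
      · rintro ⟨h1, h2⟩
        refine ⟨⟨h1, h2.trans (Nat.floor_le_floor ?_)⟩, (hiff k (by omega)).2 h2⟩
        have hi1 : ((i : ℝ) + 1) ≤ n := by exact_mod_cast mem_range.1 hi
        have ht : ((i : ℝ) + 1) ^ 2 ≤ t :=
          (Real.le_sqrt' (by positivity)).1 (hi1.trans hn)
        rw [div_le_iff₀ hc0]
        nlinarith [sq_nonneg ((i : ℝ) + 1)]
      · rintro ⟨⟨h1, _⟩, h2⟩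
        exact ⟨h1, (hiff k (by omega)).1 h2⟩
    · push_cast
      rw [div_div]
  rw [sum_congr rfl h1, sum_comm]
  refine sum_congr rfl fun k _ => ?_
  rw [← sum_filter, mul_sum]
  refine sum_congr ?_ fun _ _ => rfl
  ext i
  simp

lemma sum_inv_sqrt_le (n : ℕ) : ∑ k ∈ Icc 1 n, (Real.sqrt k)⁻¹ ≤ 2 * Real.sqrt n := by
  induction n with
  | zero => simp
  | succ n ih =>
    rw [sum_Icc_succ_top (by omega)]
    have h0 : 0 < Real.sqrt (n + 1 : ℕ) := Real.sqrt_pos.2 (by positivity)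
    have h1 := Real.sq_sqrt (Nat.cast_nonneg (α := ℝ) n)
    have h2 := Real.sq_sqrt (Nat.cast_nonneg (α := ℝ) (n + 1))
    push_cast at h0 h1 h2 ⊢
    have h3 : (Real.sqrt (n + 1))⁻¹ ≤ 2 * Real.sqrt (n + 1) - 2 * Real.sqrt n := by
      rw [inv_le_iff_one_le_mul₀ h0]
      nlinarith [sq_nonneg (Real.sqrt (n + 1) - Real.sqrt n)]
    linarith

/-- Partial sums of `D` along `(t - i²) / c` are `O(√t)`, uniformly in the length. -/
lemma exists_abs_sum_sawtoothSum_le {c : ℕ} (hc : 1 ≤ c) :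
    ∃ C : ℝ, 0 ≤ C ∧ ∀ t : ℝ, 1 ≤ t → ∀ n : ℕ, (n : ℝ) ≤ Real.sqrt t →
      |∑ i ∈ range n, sawtoothSum ((t - ((i : ℝ) + 1) ^ 2) / c)| ≤ C * Real.sqrt t := by
  have hsummable : Summable fun k : ℕ => (k : ℝ) ^ (-(9 / 8) : ℝ) :=
    Real.summable_nat_rpow.2 (by norm_num)
  set Z := ∑' k : ℕ, (k : ℝ) ^ (-(9 / 8) : ℝ) with hZ
  have hZ0 : 0 ≤ Z := tsum_nonneg fun k => by positivity
  have hc1 : (1 : ℝ) ≤ c := by exact_mod_cast hc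
  refine ⟨13 * Z + 5 * c + 12, by positivity, fun t ht n hn => ?_⟩
  set s := Real.sqrt t with hs
  have hs1 : 1 ≤ s := Real.one_le_sqrt.2 ht
  have hss : s * s = t := Real.mul_self_sqrt (by linarith)
  set K := ⌊s⌋₊ with hK
  have hK1 : 1 ≤ K := Nat.le_floor (by simpa using hs1)
  have hKs : (K : ℝ) ≤ s := Nat.floor_le (by linarith)
  have hKs' : s < K + 1 := Nat.lt_floor_add_one s
  have hKt : K ≤ ⌊t⌋₊ := Nat.floor_le_floor (by nlinarith)
  have hK1' : (1 : ℝ) ≤ K := by exact_mod_cast hK1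
  set E : ℕ → ℝ := fun k => ∑ i ∈ range (min n ⌊Real.sqrt (t - (c * k : ℕ))⌋₊),
    sawtooth ((t - ((i : ℝ) + 1) ^ 2) / (c * k : ℕ)) with hE
  have hmin : ∀ k : ℕ, ((min n ⌊Real.sqrt (t - (c * k : ℕ))⌋₊ : ℕ) : ℝ) ≤ s := fun k =>
    le_trans (by exact_mod_cast min_le_left _ _) hn
  have hsmall : ∀ k ∈ Icc 1 K, |(k : ℝ)⁻¹ * E k| ≤ 13 * s * (k : ℝ) ^ (-(9 / 8) : ℝ) + c := by
    intro k hk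
    have hk1 := (mem_Icc.1 hk).1
    have hk0 : (0 : ℝ) < k := by exact_mod_cast hk1
    have h := abs_sum_sawtooth_le_of_period (q := c * k) (Nat.mul_pos hc hk1) t
      (min n ⌊Real.sqrt (t - (c * k : ℕ))⌋₊)
    have hpow : ((c * k : ℕ) : ℝ) ^ (-1 / 8 : ℝ) ≤ (k : ℝ) ^ (-1 / 8 : ℝ) := by
      refine Real.rpow_le_rpow_of_nonpos hk0 ?_ (by norm_num)
      push_cast
      nlinarith
    have h2 : |E k| ≤ 13 * s * (k : ℝ) ^ (-1 / 8 : ℝ) + c * k := by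
      refine h.trans (add_le_add ?_ (by push_cast; exact le_rfl))
      gcongr
      exact hmin k
    rw [abs_mul, abs_of_pos (inv_pos.2 hk0)]
    calc (k : ℝ)⁻¹ * |E k| ≤ (k : ℝ)⁻¹ * (13 * s * (k : ℝ) ^ (-1 / 8 : ℝ) + c * k) := by gcongr
      _ = 13 * s * ((k : ℝ) ^ (-1 : ℝ) * (k : ℝ) ^ (-1 / 8 : ℝ)) + c := by
          rw [Real.rpow_neg_one]; field_simp
      _ = _ := by rw [← Real.rpow_add hk0]; norm_num
  have hlarge : ∀ k ∈ Ioc K ⌊t⌋₊,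
      |(k : ℝ)⁻¹ * E k| ≤ 2 * c * (Real.sqrt k)⁻¹ + 6 * t * ((k : ℝ) ^ 2)⁻¹ := by
    intro k hk
    have hk1 : 1 ≤ k := hK1.trans (mem_Ioc.1 hk).1.le
    have hk1' : (1 : ℝ) ≤ k := by exact_mod_cast hk1
    have hk0 : (0 : ℝ) < k := by linarith
    have hq : (0 : ℝ) < (c * k : ℕ) := by exact_mod_cast Nat.mul_pos hc hk1
    have h := abs_sum_sawtooth_le_of_slow t hq (min n ⌊Real.sqrt (t - (c * k : ℕ))⌋₊)
    have hks : 1 ≤ Real.sqrt k := Real.one_le_sqrt.2 hk1'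
    have hkk : Real.sqrt k * Real.sqrt k = k := Real.mul_self_sqrt hk0.le
    have h1 : Real.sqrt (c * k : ℕ) ≤ c * Real.sqrt k := by
      push_cast
      rw [Real.sqrt_mul (by linarith)]
      gcongr
      exact Real.sqrt_le_iff.2 ⟨by linarith, by nlinarith⟩
    have h2 : 3 / 2 * ((min n ⌊Real.sqrt (t - (c * k : ℕ))⌋₊ : ℕ) + 1 : ℝ) ^ 2 / (c * k : ℕ) ≤
        6 * t / k := by
      have e1 : ((min n ⌊Real.sqrt (t - (c * k : ℕ))⌋₊ : ℕ) + 1 : ℝ) ^ 2 ≤ (2 * s) ^ 2 := by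
        gcongr
        linarith [hmin k]
      refine div_le_div₀ (by linarith) (by nlinarith) hk0 ?_
      push_cast
      nlinarith
    have h3 : |E k| ≤ 2 * c * Real.sqrt k + 6 * t / k := by
      refine h.trans ?_
      nlinarith
    rw [abs_mul, abs_of_pos (inv_pos.2 hk0)]
    calc (k : ℝ)⁻¹ * |E k| ≤ (k : ℝ)⁻¹ * (2 * c * Real.sqrt k + 6 * t / k) := by gcongr
      _ = 2 * c * ((k : ℝ)⁻¹ * Real.sqrt k) + 6 * t * ((k : ℝ) ^ 2)⁻¹ := by ring
      _ = _ := by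
          congr 2
          rw [inv_mul_eq_div, Real.sqrt_div_self]
  rw [sum_sawtoothSum_sub_sq hc hn]
  refine (abs_sum_le_sum_abs _ _).trans ?_
  have hdisj : Icc 1 ⌊t⌋₊ = Icc 1 K ∪ Ioc K ⌊t⌋₊ := by
    ext k
    simp only [mem_union, mem_Icc, mem_Ioc]
    omega
  rw [hdisj, sum_union (disjoint_left.2 fun k h1 h2 => by
    rw [mem_Icc] at h1; rw [mem_Ioc] at h2; omega)]
  have hA : ∑ k ∈ Icc 1 K, |(k : ℝ)⁻¹ * E k| ≤ 13 * s * Z + c * s := by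
    refine (sum_le_sum hsmall).trans ?_
    rw [sum_add_distrib, ← mul_sum]
    refine add_le_add ?_ ?_
    · gcongr
      exact hsummable.sum_le_tsum _ fun k _ => by positivity
    · simp
      nlinarith
  have hB : ∑ k ∈ Ioc K ⌊t⌋₊, |(k : ℝ)⁻¹ * E k| ≤ 2 * c * (2 * s) + 6 * t * (2 / s) := by
    refine (sum_le_sum hlarge).trans ?_
    rw [sum_add_distrib, ← mul_sum, ← mul_sum]
    refine add_le_add ?_ ?_
    · gcongr
      refine (sum_le_sum_of_subset_of_nonneg (t := Icc 1 ⌊t⌋₊) ?_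
        fun _ _ _ => by positivity).trans ((sum_inv_sqrt_le _).trans ?_)
      · intro k hk
        rw [mem_Ioc] at hk
        rw [mem_Icc]
        omega
      · exact mul_le_mul_of_nonneg_left
          (Real.sqrt_le_sqrt (Nat.floor_le (by linarith))) two_pos.le
    · refine mul_le_mul_of_nonneg_left ?_ (by linarith)
      refine (sum_Ioc_inv_sq_le_sub (by omega) hKt).trans ?_
      have : (0 : ℝ) ≤ (⌊t⌋₊ : ℝ)⁻¹ := by positivity
      have h2 : (K : ℝ)⁻¹ ≤ 2 / s := by
        rw [inv_eq_one_div, div_le_div_iff₀ (by linarith) (by linarith)]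
        linarith
      linarith
  have hts : 6 * t * (2 / s) = 12 * s := by
    rw [← hss]; field_simp; ring
  rw [hts] at hB
  refine (add_le_add hA hB).trans (le_of_eq ?_)
  ring

lemma sum_Icc_one_eq_sum_range (f : ℕ → ℝ) (n : ℕ) :
    ∑ j ∈ Icc 1 n, f j = ∑ i ∈ range n, f (i + 1) := by
  induction n with
  | zero => simp
  | succ n ih => rw [sum_Icc_succ_top (by omega), ih, sum_range_succ]

/-- Summation by parts against the two factors of `y ^ a * (t - y) ^ b` with `y = j²`. -/
lemma abs_sum_pow_mul_pow_mul_le {t M : ℝ} (ht : 0 ≤ t) {d : ℕ → ℝ} {n : ℕ}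
    (hn : (n : ℝ) ≤ Real.sqrt t) (hd : ∀ k ≤ n, |∑ i ∈ range k, d i| ≤ M) (a b : ℕ) :
    |∑ i ∈ range n, ((i : ℝ) + 1) ^ (2 * a) * (t - ((i : ℝ) + 1) ^ 2) ^ b * d i| ≤
      2 * t ^ (a + b) * M := by
  have hM : 0 ≤ M := (abs_nonneg _).trans (hd 0 n.zero_le)
  set v : ℕ → ℝ := fun i => max (t - ((i : ℝ) + 1) ^ 2) 0 ^ b with hv
  set w : ℕ → ℝ := fun i => min (((i : ℝ) + 1) ^ 2) t ^ a with hw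
  have hv0 : ∀ i, 0 ≤ v i := fun i => by positivity
  have hw0 : ∀ i, 0 ≤ w i := fun i => pow_nonneg (le_min (by positivity) ht) _
  have hva : Antitone v := by
    intro i j hij
    simp only [hv]
    gcongr
  have hwm : Monotone w := by
    intro i j hij
    have : 0 ≤ min (((i : ℝ) + 1) ^ 2) t := le_min (by positivity) ht
    simp only [hw]
    gcongr
  have hv1 : v 0 ≤ t ^ b := by
    simp only [hv]
    gcongr
    exact max_le (by linarith [sq_nonneg (((0 : ℕ) : ℝ) + 1)]) ht
  have hw1 : w n ≤ t ^ a := pow_le_pow_left₀ (le_min (by positivity) ht) (min_le_right _ _) _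
  have h1 : ∀ k ≤ n, |∑ i ∈ range k, v i * d i| ≤ t ^ b * M := fun k hk =>
    (abs_sum_antitone_mul_le hva hv0 fun l hl => hd l (hl.trans hk)).trans
      (mul_le_mul_of_nonneg_right hv1 hM)
  have h2 := abs_sum_monotone_mul_le hwm hw0 h1
  have heq : ∑ i ∈ range n, ((i : ℝ) + 1) ^ (2 * a) * (t - ((i : ℝ) + 1) ^ 2) ^ b * d i =
      ∑ i ∈ range n, w i * (v i * d i) := by
    refine sum_congr rfl fun i hi => ?_
    have hi1 : ((i : ℝ) + 1) ≤ n := by exact_mod_cast mem_range.1 hi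
    have hit : ((i : ℝ) + 1) ^ 2 ≤ t := (Real.le_sqrt' (by positivity)).1 (hi1.trans hn)
    simp only [hv, hw]
    rw [max_eq_left (by linarith), min_eq_left hit, pow_mul]
    ring
  rw [heq]
  calc _ ≤ 2 * w n * (t ^ b * M) := h2
    _ ≤ 2 * t ^ a * (t ^ b * M) := by gcongr
    _ = _ := by rw [pow_add]; ring

lemma isBigO_sum_mul_sawtoothSum (m : ℕ) {c : ℕ} (hc : 1 ≤ c) :
    (fun t : ℝ => ∑ j ∈ Icc 1 ⌊Real.sqrt t⌋₊,
      (∑ k ∈ range (m + 1), ((m.choose k : ℝ) / ((k : ℝ) + 2)) * (j : ℝ) ^ (2 * (m - k)) *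
        (t - (j : ℝ) ^ 2) ^ (k + 1)) * sawtoothSum ((t - (j : ℝ) ^ 2) / c))
      =O[atTop] (fun t : ℝ => t ^ ((m : ℝ) + 3 / 2)) := by
  obtain ⟨C, hC0, hC⟩ := exists_abs_sum_sawtoothSum_le hc
  refine IsBigO.of_bound (∑ k ∈ range (m + 1), ((m.choose k : ℝ) / ((k : ℝ) + 2)) * (2 * C)) ?_
  filter_upwards [eventually_ge_atTop 1] with t ht
  have ht0 : 0 < t := by linarith
  have hn : ((⌊Real.sqrt t⌋₊ : ℕ) : ℝ) ≤ Real.sqrt t := Nat.floor_le (Real.sqrt_nonneg t)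
  have hpow : t ^ ((m : ℝ) + 3 / 2) = t ^ (m + 1) * Real.sqrt t := by
    rw [Real.sqrt_eq_rpow, ← Real.rpow_natCast, ← Real.rpow_add ht0]
    push_cast
    congr 1
    ring
  rw [Real.norm_eq_abs, Real.norm_of_nonneg (by positivity), hpow, sum_mul,
    sum_Icc_one_eq_sum_range]
  simp_rw [sum_mul]
  rw [sum_comm]
  refine (abs_sum_le_sum_abs _ _).trans (sum_le_sum fun k hk => ?_)
  have h := abs_sum_pow_mul_pow_mul_le ht0.le hn
    (d := fun i : ℕ => sawtoothSum ((t - ((i : ℝ) + 1) ^ 2) / c)) (M := C * Real.sqrt t)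
    (fun l hl => hC t ht l (le_trans (by exact_mod_cast hl) hn)) (m - k) (k + 1)
  have hmk : m - k + (k + 1) = m + 1 := by
    have := mem_range.1 hk
    omega
  rw [hmk] at h
  have hfac : ∑ i ∈ range ⌊Real.sqrt t⌋₊, (m.choose k : ℝ) / ((k : ℝ) + 2) *
      ((i + 1 : ℕ) : ℝ) ^ (2 * (m - k)) * (t - ((i + 1 : ℕ) : ℝ) ^ 2) ^ (k + 1) *
        sawtoothSum ((t - ((i + 1 : ℕ) : ℝ) ^ 2) / c) =
      (m.choose k : ℝ) / ((k : ℝ) + 2) * ∑ i ∈ range ⌊Real.sqrt t⌋₊,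
        ((i : ℝ) + 1) ^ (2 * (m - k)) * (t - ((i : ℝ) + 1) ^ 2) ^ (k + 1) *
          sawtoothSum ((t - ((i : ℝ) + 1) ^ 2) / c) := by
    rw [mul_sum]
    refine sum_congr rfl fun i _ => ?_
    push_cast
    ring
  have hb : 0 ≤ (m.choose k : ℝ) / ((k : ℝ) + 2) := by positivity
  rw [hfac, abs_mul, abs_of_nonneg hb]
  refine (mul_le_mul_of_nonneg_left h hb).trans (le_of_eq ?_)
  ring

/-- **Bounds on the correction sums `H` and `L` (Section 5).**
For an integer `m ≥ 1`, with `ψ(x) = x − ⌊x⌋ − 1/2`, `D(t) = Σ_{1≤k≤⌊t⌋} ψ(t/k)/k` and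
`F(t,j) = Σ_{k=0}^{m} (binom(m,k)/(k+2)) j^{2(m−k)} (t−j²)^{k+1}`, the sums
`H(t) = Σ_{j=1}^{⌊√t⌋} F(t,j) D(t−j²)` and `L(t) = Σ_{j=1}^{⌊√t⌋} F(t,j) D((t−j²)/4)`
are both `O(t^{m+3/2})` as `t → ∞`. -/
theorem stmt16 (m : ℕ) (hm : 1 ≤ m)
    (ψ : ℝ → ℝ) (hψ : ∀ x : ℝ, ψ x = x - (⌊x⌋ : ℝ) - 1 / 2)
    (D : ℝ → ℝ) (hD : ∀ t : ℝ, D t = ∑ k ∈ Finset.Icc 1 ⌊t⌋₊, (k : ℝ)⁻¹ * ψ (t / k))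
    (F : ℝ → ℕ → ℝ)
    (hF : ∀ (t : ℝ) (j : ℕ), F t j = ∑ k ∈ Finset.range (m + 1),
      ((m.choose k : ℝ) / ((k : ℝ) + 2)) * (j : ℝ) ^ (2 * (m - k)) *
        (t - (j : ℝ) ^ 2) ^ (k + 1))
    (H L : ℝ → ℝ)
    (hH : ∀ t : ℝ, H t = ∑ j ∈ Finset.Icc 1 ⌊Real.sqrt t⌋₊, F t j * D (t - (j : ℝ) ^ 2))
    (hL : ∀ t : ℝ, L t = ∑ j ∈ Finset.Icc 1 ⌊Real.sqrt t⌋₊,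
      F t j * D ((t - (j : ℝ) ^ 2) / 4)) :
    H =O[atTop] (fun t : ℝ => t ^ ((m : ℝ) + 3 / 2)) ∧
      L =O[atTop] (fun t : ℝ => t ^ ((m : ℝ) + 3 / 2)) := by
  obtain rfl : ψ = sawtooth := funext fun x => hψ x
  obtain rfl : D = sawtoothSum := funext hD
  obtain rfl : H = _ := funext hH
  obtain rfl : L = _ := funext hL
  simp only [hF]
  exact ⟨by simpa using isBigO_sum_mul_sawtoothSum m le_rfl,
    by simpa using isBigO_sum_mul_sawtoothSum m (c := 4) (by norm_num)⟩
end

section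
/- For β > −1/2 and t ≥ 0 let J_β(t) = ((t/2)^β / (Γ(β+1/2) Γ(1/2))) ∫_{−1}^{1} e^{its} (1−s²)^{β−1/2} ds denote the Bessel function of the first kind of order β (Poisson integral representation). Let α ≥ 2 and β > −1/2. Then there exist constants M > 0 and c > 0 such that for every z ≥ M, ∫_{0}^{z} t^{α+β} J_β(t) dt ≤ c z^{α+β−1/2}. -/
open MeasureTheory Filter Asymptotics intervalIntegral

theorem exists_bound_rpow_mul_deriv {f f' f'' : ℝ → ℝ} {γ : ℝ}
    (hf : ∀ t, HasDerivAt f (f' t) t) (hf' : ∀ t, HasDerivAt f' (f'' t) t)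
    (hode : ∀ t, t * (f'' t + f t) + 2 * γ * f' t = 0) :
    ∃ K, 0 ≤ K ∧ ∀ t, 1 ≤ t → |t ^ γ * f' t| ≤ K := by
  set μ := γ * (γ - 1) with hμ
  set u : ℝ → ℝ := fun t => t ^ γ * f t with hu
  set v : ℝ → ℝ := fun t => t ^ γ * (f' t + γ * f t / t) with hv
  have hpow : ∀ t : ℝ, 0 < t → HasDerivAt (fun t : ℝ => t ^ γ) (γ * (t ^ γ / t)) t := by
    intro t ht
    have := Real.hasDerivAt_rpow_const (x := t) (p := γ) (Or.inl ht.ne')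
    rwa [Real.rpow_sub_one ht.ne'] at this
  have hu' : ∀ t, 0 < t → HasDerivAt u (v t) t := by
    intro t ht
    refine ((hpow t ht).mul (hf t)).congr_deriv ?_
    simp only [hv]
    field_simp
    ring
  have hv' : ∀ t, 0 < t → HasDerivAt v (-(1 - μ / t ^ 2) * u t) t := by
    intro t ht
    refine ((hpow t ht).mul ((hf' t).add
      (((hf t).const_mul γ).div (hasDerivAt_id t) ht.ne'))).congr_deriv ?_
    have h2 : f'' t = -f t - 2 * γ * f' t / t := by
      field_simp
      linear_combination hode t
    simp only [hu, hμ, id, h2, Pi.add_apply, Pi.div_apply]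
    field_simp
    ring
  set Φ : ℝ → ℝ := fun t => (u t ^ 2 + v t ^ 2) * Real.exp (|μ| / t) with hΦ
  have hΦ' : ∀ t, 0 < t → HasDerivAt Φ
      ((2 * μ * (u t * v t) - |μ| * (u t ^ 2 + v t ^ 2)) / t ^ 2 * Real.exp (|μ| / t)) t := by
    intro t ht
    have he := (((hasDerivAt_const t |μ|).div (hasDerivAt_id t) ht.ne')).exp
    refine ((((hu' t ht).pow 2).add ((hv' t ht).pow 2)).mul he).congr_deriv ?_
    simp only [id, Pi.add_apply, Pi.pow_apply, Pi.div_apply]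
    field_simp
    ring
  have hanti : AntitoneOn Φ (Set.Ici 1) := by
    refine antitoneOn_of_hasDerivWithinAt_nonpos (convex_Ici 1)
      (fun t ht => (hΦ' t (zero_lt_one.trans_le ht)).continuousAt.continuousWithinAt)
      (fun t ht => ((hΦ' t ?_).hasDerivWithinAt)) (fun t ht => ?_)
    · rw [interior_Ici] at ht
      exact zero_lt_one.trans ht
    · refine mul_nonpos_of_nonpos_of_nonneg
        (div_nonpos_of_nonpos_of_nonneg ?_ (sq_nonneg t)) (Real.exp_pos _).le
      have h1 : μ * (u t * v t) ≤ |μ| * (|u t| * |v t|) := by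
        rw [← abs_mul, ← abs_mul]
        exact le_abs_self _
      have h2 := mul_nonneg (abs_nonneg μ) (sq_nonneg (|u t| - |v t|))
      rw [← sq_abs (u t), ← sq_abs (v t)]
      linarith
  have hE : ∀ t, 1 ≤ t → u t ^ 2 + v t ^ 2 ≤ Φ 1 := by
    intro t ht
    refine le_trans ?_ (hanti Set.self_mem_Ici ht ht)
    exact le_mul_of_one_le_right (by positivity) (Real.one_le_exp (by positivity))
  refine ⟨√(Φ 1) + |γ| * √(Φ 1), by positivity, fun t ht => ?_⟩
  have ht0 : 0 < t := zero_lt_one.trans_le ht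
  have hu1 : |u t| ≤ √(Φ 1) := Real.abs_le_sqrt (by nlinarith [hE t ht, sq_nonneg (v t)])
  have hv1 : |v t| ≤ √(Φ 1) := Real.abs_le_sqrt (by nlinarith [hE t ht, sq_nonneg (u t)])
  have h : t ^ γ * f' t = v t - γ * (u t / t) := by
    simp only [hu, hv]
    field_simp
    ring
  rw [h]
  refine (abs_sub _ _).trans (add_le_add hv1 ?_)
  rw [abs_mul, abs_div, abs_of_pos ht0]
  gcongr
  exact (div_le_self (abs_nonneg _) ht).trans hu1

theorem exists_integral_rpow_mul_le {f f' f'' : ℝ → ℝ} {γ a : ℝ}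
    (hf : ∀ t, HasDerivAt f (f' t) t) (hf' : ∀ t, HasDerivAt f' (f'' t) t)
    (hode : ∀ t, t * (f'' t + f t) + 2 * γ * f' t = 0) (ha : 0 ≤ a) (haγ : 2 * γ ≤ a)
    (hlt : γ < a) :
    ∃ c > 0, ∀ z, 1 ≤ z → ∫ t in (0 : ℝ)..z, t ^ a * f t ≤ c * z ^ (a - γ) := by
  obtain ⟨K, hK, hb⟩ := exists_bound_rpow_mul_deriv hf hf' hode
  set e := a - γ with he
  have he0 : 0 < e := sub_pos.2 hlt
  have hsplit : ∀ t : ℝ, 0 < t → t ^ a = t ^ e * t ^ γ := by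
    intro t ht
    rw [← Real.rpow_add ht, he, sub_add_cancel]
  have hpow : ∀ (b t : ℝ), 0 < t → HasDerivAt (fun t : ℝ => t ^ b) (b * (t ^ b / t)) t := by
    intro b t ht
    have := Real.hasDerivAt_rpow_const (x := t) (p := b) (Or.inl ht.ne')
    rwa [Real.rpow_sub_one ht.ne'] at this
  have hcont : Continuous fun t : ℝ => t ^ a * f t :=
    (Real.continuous_rpow_const ha).mul
      (continuous_iff_continuousAt.2 fun t => (hf t).continuousAt)
  set Ψ : ℝ → ℝ := fun z =>
    (∫ t in (0 : ℝ)..z, t ^ a * f t) + z ^ a * f' z - (a - 2 * γ) * K / e * z ^ e with hΨ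
  have hΨ' : ∀ t, 0 < t → HasDerivAt Ψ
      ((a - 2 * γ) * (t ^ e / t) * (t ^ γ * f' t - K)) t := by
    intro t ht
    refine (((integral_hasDerivAt_right (hcont.intervalIntegrable 0 t)
      (hcont.stronglyMeasurableAtFilter _ _) hcont.continuousAt).add ((hpow a t ht).mul (hf' t))).sub
      ((hpow e t ht).const_mul _)).congr_deriv ?_
    have h2 : f'' t = -f t - 2 * γ * f' t / t := by
      field_simp
      linear_combination hode t
    rw [h2, hsplit t ht]
    field_simp
    ring
  have hanti : AntitoneOn Ψ (Set.Ici 1) := by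
    refine antitoneOn_of_hasDerivWithinAt_nonpos (convex_Ici 1)
      (fun t ht => (hΨ' t (zero_lt_one.trans_le ht)).continuousAt.continuousWithinAt)
      (fun t ht => ((hΨ' t ?_).hasDerivWithinAt)) (fun t ht => ?_)
    · rw [interior_Ici] at ht
      exact zero_lt_one.trans ht
    · rw [interior_Ici] at ht
      have ht0 : 0 < t := zero_lt_one.trans ht
      refine mul_nonpos_of_nonneg_of_nonpos (mul_nonneg (by linarith) (by positivity)) ?_
      linarith [le_of_abs_le (hb t (le_of_lt ht))]
  refine ⟨|Ψ 1| + K + (a - 2 * γ) * K / e + 1, ?_, fun z hz => ?_⟩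
  · have : 0 ≤ (a - 2 * γ) * K / e := div_nonneg (mul_nonneg (by linarith) hK) he0.le
    positivity
  · have hz0 : 0 < z := zero_lt_one.trans_le hz
    have h1 : Ψ z ≤ Ψ 1 := hanti Set.self_mem_Ici hz hz
    have h2 : 1 ≤ z ^ e := Real.one_le_rpow hz he0.le
    have h3 : -(z ^ a * f' z) ≤ K * z ^ e := by
      rw [hsplit z hz0]
      nlinarith [neg_le_of_abs_le (hb z hz)]
    have h4 : Ψ 1 ≤ |Ψ 1| * z ^ e :=
      (le_abs_self _).trans (le_mul_of_one_le_right (abs_nonneg _) h2)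
    simp only [hΨ] at h1 h4 ⊢
    linarith

theorem intervalIntegrable_one_sub_sq_rpow {p : ℝ} (hp : -1 < p) :
    IntervalIntegrable (fun s : ℝ => (1 - s ^ 2) ^ p) volume (-1) 1 := by
  have hright : IntervalIntegrable (fun s : ℝ => (1 - s ^ 2) ^ p) volume 0 1 := by
    have h1 : IntervalIntegrable (fun s : ℝ => (1 - s) ^ p) volume 0 1 := by
      have := (intervalIntegrable_rpow' (a := 1) (b := 0) hp).comp_sub_left 1 (by simp)
      simpa using this
    have h2 : ContinuousOn (fun s : ℝ => (1 + s) ^ p) (Set.uIcc 0 1) := by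
      refine ContinuousOn.rpow_const (by fun_prop) fun s hs => Or.inl ?_
      rw [Set.uIcc_of_le zero_le_one] at hs
      linarith [hs.1]
    refine (h1.continuousOn_mul h2).congr fun s hs => ?_
    rw [Set.uIoc_of_le zero_le_one] at hs
    rw [← Real.mul_rpow (by linarith [hs.1]) (by linarith [hs.2])]
    ring_nf
  have hleft : IntervalIntegrable (fun s : ℝ => (1 - s ^ 2) ^ p) volume (-1) 0 := by
    have := hright.comp_sub_left 0 (by simp)
    simpa using this.symm
  exact hleft.trans hright

theorem hasDerivAt_integral_cos_mul {w : ℝ → ℝ} {a b : ℝ} (hw : IntervalIntegrable w volume a b)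
    (t : ℝ) :
    HasDerivAt (fun t => ∫ s in a..b, Real.cos (t * s) * w s)
      (∫ s in a..b, -(Real.sin (t * s) * (s * w s))) t := by
  have hsw : IntervalIntegrable (fun s => s * w s) volume a b :=
    hw.continuousOn_mul continuousOn_id
  refine (intervalIntegral.hasDerivAt_integral_of_dominated_loc_of_deriv_le (bound := fun s => |s * w s|)
    (F := fun t s => Real.cos (t * s) * w s) (F' := fun t s => -(Real.sin (t * s) * (s * w s)))
    univ_mem (.of_forall fun x => ?_) ?_ ?_ (.of_forall fun s _ x _ => ?_) hsw.abs
    (.of_forall fun s _ x _ => ?_)).2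
  · exact (intervalIntegrable_iff.1 (hw.continuousOn_mul (by fun_prop))).aestronglyMeasurable
  · exact hw.continuousOn_mul (by fun_prop)
  · exact (intervalIntegrable_iff.1 ((hsw.continuousOn_mul (by fun_prop)).neg)).aestronglyMeasurable
  · rw [norm_neg, norm_mul]
    exact mul_le_of_le_one_left (norm_nonneg _) (Real.abs_sin_le_one _)
  · refine ((((hasDerivAt_id x).mul_const s).cos).mul_const (w s)).congr_deriv ?_
    simp only [id]
    ring

theorem hasDerivAt_integral_sin_mul {w : ℝ → ℝ} {a b : ℝ} (hw : IntervalIntegrable w volume a b)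
    (t : ℝ) :
    HasDerivAt (fun t => ∫ s in a..b, Real.sin (t * s) * w s)
      (∫ s in a..b, Real.cos (t * s) * (s * w s)) t := by
  have hsw : IntervalIntegrable (fun s => s * w s) volume a b :=
    hw.continuousOn_mul continuousOn_id
  refine (intervalIntegral.hasDerivAt_integral_of_dominated_loc_of_deriv_le (bound := fun s => |s * w s|)
    (F := fun t s => Real.sin (t * s) * w s) (F' := fun t s => Real.cos (t * s) * (s * w s))
    univ_mem (.of_forall fun x => ?_) ?_ ?_ (.of_forall fun s _ x _ => ?_) hsw.abs
    (.of_forall fun s _ x _ => ?_)).2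
  · exact (intervalIntegrable_iff.1 (hw.continuousOn_mul (by fun_prop))).aestronglyMeasurable
  · exact hw.continuousOn_mul (by fun_prop)
  · exact (intervalIntegrable_iff.1 (hsw.continuousOn_mul (by fun_prop))).aestronglyMeasurable
  · rw [norm_mul]
    exact mul_le_of_le_one_left (norm_nonneg _) (Real.abs_cos_le_one _)
  · refine ((((hasDerivAt_id x).mul_const s).sin).mul_const (w s)).congr_deriv ?_
    simp only [id]
    ring

theorem integral_cos_mul_one_sub_sq_rpow {p : ℝ} (hp : -1 < p) (t : ℝ) :
    t * ((∫ s in (-1 : ℝ)..1, -(Real.cos (t * s) * (s * (s * (1 - s ^ 2) ^ p)))) +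
        ∫ s in (-1 : ℝ)..1, Real.cos (t * s) * (1 - s ^ 2) ^ p) +
      2 * (p + 1) * (∫ s in (-1 : ℝ)..1, -(Real.sin (t * s) * (s * (1 - s ^ 2) ^ p))) = 0 := by
  have hw := intervalIntegrable_one_sub_sq_rpow hp
  have hsw : IntervalIntegrable (fun s : ℝ => s * (1 - s ^ 2) ^ p) volume (-1) 1 :=
    hw.continuousOn_mul continuousOn_id
  have hssw : IntervalIntegrable (fun s : ℝ => s * (s * (1 - s ^ 2) ^ p)) volume (-1) 1 :=
    hsw.continuousOn_mul continuousOn_id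
  have h1 : IntervalIntegrable (fun s => -(Real.cos (t * s) * (s * (s * (1 - s ^ 2) ^ p))))
      volume (-1) 1 := (hssw.continuousOn_mul (by fun_prop)).neg
  have h2 : IntervalIntegrable (fun s => Real.cos (t * s) * (1 - s ^ 2) ^ p) volume (-1) 1 :=
    hw.continuousOn_mul (by fun_prop)
  have h3 : IntervalIntegrable (fun s => -(Real.sin (t * s) * (s * (1 - s ^ 2) ^ p)))
      volume (-1) 1 := (hsw.continuousOn_mul (by fun_prop)).neg
  rw [← intervalIntegral.integral_add h1 h2, ← intervalIntegral.integral_const_mul, ← intervalIntegral.integral_const_mul,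
    ← intervalIntegral.integral_add ((h1.add h2).const_mul t) (h3.const_mul _)]
  rw [integral_eq_sub_of_hasDerivAt_of_le (f := fun s => Real.sin (t * s) * (1 - s ^ 2) ^ (p + 1))
    (by norm_num) _ _ (((h1.add h2).const_mul t).add (h3.const_mul _))]
  · simp [Real.zero_rpow (by linarith : p + 1 ≠ 0)]
  · exact ContinuousOn.mul (by fun_prop)
      (ContinuousOn.rpow_const (by fun_prop) fun s _ => Or.inr (by linarith))
  · intro s hs
    have hpos : 0 < 1 - s ^ 2 := by nlinarith [hs.1, hs.2]
    refine ((((hasDerivAt_id s).const_mul t).sin).mul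
      ((((hasDerivAt_id s).pow 2).const_sub 1).rpow_const (p := p + 1)
        (Or.inl hpos.ne'))).congr_deriv ?_
    simp only [id, Pi.pow_apply, add_sub_cancel_right, Real.rpow_add_one hpos.ne']
    push_cast
    ring

theorem re_integral_cexp_mul {w : ℝ → ℝ} {a b : ℝ} (hw : IntervalIntegrable w volume a b)
    (t : ℝ) :
    (∫ s in a..b, Complex.exp ((t : ℂ) * (s : ℂ) * Complex.I) * ((w s : ℝ) : ℂ)).re =
      ∫ s in a..b, Real.cos (t * s) * w s := by
  have hint : IntervalIntegrable
      (fun s : ℝ => Complex.exp ((t : ℂ) * (s : ℂ) * Complex.I) * ((w s : ℝ) : ℂ)) volume a b :=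
    IntervalIntegrable.continuousOn_mul (f := fun s => ((w s : ℝ) : ℂ)) ⟨hw.1.ofReal, hw.2.ofReal⟩ (by fun_prop)
  refine (intervalIntegral.intervalIntegral_re hint).symm.trans (integral_congr fun s _ => ?_)
  simp only [RCLike.re_to_complex, Complex.re_mul_ofReal]
  rw [← Complex.ofReal_mul, Complex.exp_ofReal_mul_I_re]

/-- **Weighted Bessel integral estimate (Proposition A.1).**
Let `J_β` be the Bessel function of the first kind given by the Poisson integral
representation
`J_β(t) = ((t/2)^β/(Γ(β+1/2)Γ(1/2))) ∫_{−1}^{1} e^{its}(1−s²)^{β−1/2} ds` for `t ≥ 0`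
and `β > −1/2`.  For `α ≥ 2` and `β > −1/2` there are constants `M > 0` and `c > 0`
such that `∫_0^z t^{α+β} J_β(t) dt ≤ c z^{α+β−1/2}` for every `z ≥ M`. -/
theorem stmt17 (J : ℝ → ℝ → ℝ)
    (hJ : ∀ β : ℝ, -(1 / 2) < β → ∀ t : ℝ, 0 ≤ t →
      (J β t : ℂ) = ((((t / 2) ^ β / (Real.Gamma (β + 1 / 2) * Real.Gamma (1 / 2))) : ℝ) : ℂ) *
        ∫ s in (-1 : ℝ)..1,
          Complex.exp ((t : ℂ) * (s : ℂ) * Complex.I) * ((((1 - s ^ 2) ^ (β - 1 / 2)) : ℝ) : ℂ))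
    (α β : ℝ) (hα : 2 ≤ α) (hβ : -(1 / 2) < β) :
    ∃ M > (0 : ℝ), ∃ c > (0 : ℝ), ∀ z : ℝ, M ≤ z →
      (∫ t in (0 : ℝ)..z, t ^ (α + β) * J β t) ≤ c * z ^ (α + β - 1 / 2) := by
  have hp : -1 < β - 1 / 2 := by linarith
  have hw := intervalIntegrable_one_sub_sq_rpow hp
  have hsw : IntervalIntegrable (fun s : ℝ => s * (1 - s ^ 2) ^ (β - 1 / 2)) volume (-1) 1 :=
    hw.continuousOn_mul continuousOn_id
  have hsecond (t : ℝ) := (hasDerivAt_integral_sin_mul hsw t).neg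
  simp only [Pi.neg_def, ← intervalIntegral.integral_neg] at hsecond
  obtain ⟨c, hc, hbound⟩ := exists_integral_rpow_mul_le (γ := β + 1 / 2) (a := α + 2 * β)
    (hasDerivAt_integral_cos_mul hw) hsecond
    (fun t => by
      have := integral_cos_mul_one_sub_sq_rpow hp t
      rwa [show β - 1 / 2 + 1 = β + 1 / 2 by ring] at this)
    (by linarith) (by linarith) (by linarith)
  set C : ℝ := ((2 : ℝ) ^ β)⁻¹ / (Real.Gamma (β + 1 / 2) * Real.Gamma (1 / 2)) with hC
  have hCpos : 0 < C := by
    have h1 : 0 < Real.Gamma (β + 1 / 2) := Real.Gamma_pos_of_pos (by linarith)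
    have h2 : 0 < Real.Gamma (1 / 2) := Real.Gamma_pos_of_pos (by norm_num)
    positivity
  refine ⟨1, one_pos, C * c, mul_pos hCpos hc, fun z hz => ?_⟩
  have heq : ∫ t in (0 : ℝ)..z, t ^ (α + β) * J β t = C * ∫ t in (0 : ℝ)..z, t ^ (α + 2 * β) *
      ∫ s in (-1 : ℝ)..1, Real.cos (t * s) * (1 - s ^ 2) ^ (β - 1 / 2) := by
    rw [← intervalIntegral.integral_const_mul]
    refine integral_congr_ae (.of_forall fun t ht => ?_)
    rw [Set.uIoc_of_le (zero_le_one.trans hz)] at ht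
    have hre := congrArg Complex.re (hJ β hβ t ht.1.le)
    rw [Complex.ofReal_re, Complex.re_ofReal_mul, re_integral_cexp_mul hw] at hre
    rw [hre, Real.div_rpow ht.1.le zero_le_two, show α + 2 * β = α + β + β by ring,
      Real.rpow_add ht.1 (α + β) β, hC]
    ring
  rw [heq, mul_assoc, show α + β - 1 / 2 = α + 2 * β - (β + 1 / 2) by ring]
  exact mul_le_mul_of_nonneg_left (hbound z hz) hCpos.le
end
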